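/- arXiv:1603.06352 — 8 statements merged into one kernel-verified Lean document; each statement's English description precedes it below -/
import Mathlib

section
/- Fix integers N, T, d ≥ 1 and loss vectors ℓ₁,…,ℓ_T ∈ [−1,1]^N whose N×T loss matrix L (with columns ℓ_t) has rank d. Consider any sequence x₁,…,x_T ∈ Δ_N generated by the Online Low Rank Experts algorithm: x₁ = (1/N)𝟙; the algorithm maintains a list of 'novel' loss vectors, and at each step t, if ℓ_t is not in the span of the previously stored losses, ℓ_t is stored as a new column (after which there are k stored columns, forming the matrix B_k ∈ ℝ^{N×k}), the within-epoch counter τ is reset to 0, and a new regularizer H_k = I_N + B_k M_k B_kᵀ is formed, where M_k is any k×k symmetric positive definite matrix satisfying {v ∈ ℝ^k : vᵀM_k⁻¹v ≤ 1/(2k)} ⊆ {v ∈ ℝ^k : ‖B_k v‖_∞ ≤ 1} ⊆ {v ∈ ℝ^k : vᵀM_k⁻¹v ≤ 1}; then, with k the current number of stored columns, τ incremented by 1 and η_t = 4√(k/τ), the next iterate is the unique minimizer x_{t+1} = argmin_{x ∈ Δ_N} [ℓ_t·x + η_t⁻¹ (x−x_t)ᵀ H_k (x−x_t)]. Then for any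 such run, Σ_{t=1}^T x_t·ℓ_t − min_{i∈[N]} Σ_{t=1}^T ℓ_t(i) ≤ 8 d √T. -/
open Matrix

/-- `ℓ t` is "novel": it does not lie in the span of the previously observed losses. -/
def IsNovel (N : ℕ) (ℓ : ℕ → Fin N → ℝ) (t : ℕ) : Prop :=
  ℓ t ∉ Submodule.span ℝ {w : Fin N → ℝ | ∃ s < t, ℓ s = w}

open scoped Classical in
/-- `k` after processing step `t`: the number of stored (novel) loss vectors among
`ℓ 0, …, ℓ t`. -/
noncomputable def novelCount (N : ℕ) (ℓ : ℕ → Fin N → ℝ) (t : ℕ) : ℕ :=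
  ((Finset.range (t + 1)).filter (IsNovel N ℓ)).card

open scoped Classical in
/-- The within-epoch counter `τ` at step `t` (after the increment): the number of steps
since the most recent novel step (inclusive); if no novel step has occurred it is `t+1`. -/
noncomputable def tauCount (N : ℕ) (ℓ : ℕ → Fin N → ℝ) (t : ℕ) : ℕ :=
  t + 1 - ((Finset.range (t + 1)).filter (IsNovel N ℓ)).sup id

/-- Cauchy–Schwarz for a positive semidefinite form. -/
lemma aux_cs {n : ℕ} (M : Matrix (Fin n) (Fin n) ℝ) (hs : M.IsSymm)
    (hp : ∀ u : Fin n → ℝ, 0 ≤ u ⬝ᵥ M.mulVec u) (a y : Fin n → ℝ) :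
    (a ⬝ᵥ M.mulVec y) ^ 2 ≤ (a ⬝ᵥ M.mulVec a) * (y ⬝ᵥ M.mulVec y) := by
  have hsym : y ⬝ᵥ M.mulVec a = a ⬝ᵥ M.mulVec y := by
    rw [dotProduct_mulVec, ← mulVec_transpose, hs.eq, dotProduct_comm]
  have h : ∀ s : ℝ, 0 ≤ (y ⬝ᵥ M.mulVec y) * (s * s) + (2 * (a ⬝ᵥ M.mulVec y)) * s
      + a ⬝ᵥ M.mulVec a := by
    intro s
    have := hp (a + s • y)
    simp only [mulVec_add, mulVec_smul, dotProduct_add, add_dotProduct, smul_dotProduct,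
      dotProduct_smul, smul_eq_mul, hsym] at this
    linarith
  have := discrim_le_zero h
  unfold discrim at this
  nlinarith

/-- Dual-norm estimate. -/
lemma aux_dual {n : ℕ} (M : Matrix (Fin n) (Fin n) ℝ) (hs : M.IsSymm) (hM : M.PosDef)
    (v y : Fin n → ℝ) :
    (v ⬝ᵥ y) ^ 2 ≤ (v ⬝ᵥ M⁻¹.mulVec v) * (y ⬝ᵥ M.mulVec y) := by
  have hdet : IsUnit M.det := (Matrix.isUnit_iff_isUnit_det M).1 hM.isUnit
  have hp : ∀ u : Fin n → ℝ, 0 ≤ u ⬝ᵥ M.mulVec u := fun u => by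
    simpa using hM.posSemidef.dotProduct_mulVec_nonneg u
  have hv : M.mulVec (M⁻¹.mulVec v) = v := by
    rw [mulVec_mulVec, Matrix.mul_nonsing_inv _ hdet, one_mulVec]
  have h := aux_cs M hs hp y (M⁻¹.mulVec v)
  rw [hv] at h
  rw [dotProduct_comm v y, dotProduct_comm v, mul_comm]
  exact h

lemma aux_simplex_dot {N : ℕ} (w z x : Fin N → ℝ) (hw : ∀ i, |w i| ≤ 1)
    (hz : z ∈ stdSimplex ℝ (Fin N)) (hx : x ∈ stdSimplex ℝ (Fin N)) :
    w ⬝ᵥ (z - x) ≤ 2 := by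
  rw [dotProduct_sub]
  have h1 : w ⬝ᵥ z ≤ 1 := by
    rw [← hz.2]
    refine Finset.sum_le_sum fun i _ => ?_
    nlinarith [hz.1 i, (abs_le.1 (hw i)).2]
  have h2 : -1 ≤ w ⬝ᵥ x := by
    rw [← hx.2, ← Finset.sum_neg_distrib]
    refine Finset.sum_le_sum fun i _ => ?_
    nlinarith [hx.1 i, (abs_le.1 (hw i)).1]
  linarith

lemma aux_simplex_sq {N : ℕ} (z x : Fin N → ℝ)
    (hz : z ∈ stdSimplex ℝ (Fin N)) (hx : x ∈ stdSimplex ℝ (Fin N)) :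
    (z - x) ⬝ᵥ (z - x) ≤ 2 := by
  apply aux_simplex_dot _ _ _ _ hz hx
  intro i
  have h1 : z i ≤ 1 := by
    rw [← hz.2]; exact Finset.single_le_sum (fun j _ => hz.1 j) (Finset.mem_univ i)
  have h2 : x i ≤ 1 := by
    rw [← hx.2]; exact Finset.single_le_sum (fun j _ => hx.1 j) (Finset.mem_univ i)
  rw [Pi.sub_apply, abs_le]
  constructor <;> linarith [hz.1 i, hx.1 i]

/-- The properties of the regularizer used in the analysis. -/
def GoodReg (N : ℕ) (S : Submodule ℝ (Fin N → ℝ)) (k : ℕ) (H : Matrix (Fin N) (Fin N) ℝ) :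
    Prop :=
  H.IsSymm ∧ (∀ u : Fin N → ℝ, 0 ≤ u ⬝ᵥ H.mulVec u) ∧
  (∀ w ∈ S, (∀ i, |w i| ≤ 1) → ∀ u : Fin N → ℝ, (w ⬝ᵥ u) ^ 2 ≤ u ⬝ᵥ H.mulVec u) ∧
  (∀ z ∈ stdSimplex ℝ (Fin N), ∀ x ∈ stdSimplex ℝ (Fin N),
    (z - x) ⬝ᵥ H.mulVec (z - x) ≤ 10 * (k : ℝ))

lemma aux_good {N k : ℕ} (hk : 1 ≤ k) (S : Submodule ℝ (Fin N → ℝ))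
    (B : Matrix (Fin N) (Fin k) ℝ) (M : Matrix (Fin k) (Fin k) ℝ)
    (hS : ∀ w ∈ S, ∃ v, B.mulVec v = w)
    (hs : M.IsSymm) (hM : M.PosDef)
    (h1 : ∀ w : Fin k → ℝ, w ⬝ᵥ M⁻¹.mulVec w ≤ 1 / (2 * (k : ℝ)) →
          ∀ i, |B.mulVec w i| ≤ 1)
    (h2 : ∀ w : Fin k → ℝ, (∀ i, |B.mulVec w i| ≤ 1) → w ⬝ᵥ M⁻¹.mulVec w ≤ 1) :
    GoodReg N S k (1 + B * M * Bᵀ) := by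
  have hdet : IsUnit M.det := (Matrix.isUnit_iff_isUnit_det M).1 hM.isUnit
  have hp : ∀ u : Fin k → ℝ, 0 ≤ u ⬝ᵥ M.mulVec u := fun u => by
    simpa using hM.posSemidef.dotProduct_mulVec_nonneg u
  have hq : ∀ u : Fin N → ℝ, u ⬝ᵥ (1 + B * M * Bᵀ).mulVec u
      = u ⬝ᵥ u + (Bᵀ.mulVec u) ⬝ᵥ M.mulVec (Bᵀ.mulVec u) := by
    intro u
    rw [add_mulVec, one_mulVec, dotProduct_add, ← mulVec_mulVec, ← mulVec_mulVec,
      dotProduct_mulVec u B, ← mulVec_transpose]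
  have huu : ∀ u : Fin N → ℝ, 0 ≤ u ⬝ᵥ u := fun u =>
    Finset.sum_nonneg fun i _ => mul_self_nonneg _
  have hBd : ∀ (v : Fin k → ℝ) (u : Fin N → ℝ), B.mulVec v ⬝ᵥ u = v ⬝ᵥ Bᵀ.mulVec u := by
    intro v u
    rw [dotProduct_comm, dotProduct_mulVec, ← mulVec_transpose, dotProduct_comm]
  refine ⟨?_, ?_, ?_, ?_⟩
  · unfold Matrix.IsSymm
    simp [Matrix.transpose_add, Matrix.transpose_mul, hs.eq, Matrix.mul_assoc]
  · intro u
    rw [hq]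
    linarith [huu u, hp (Bᵀ.mulVec u)]
  · intro w hw hwb u
    obtain ⟨v, rfl⟩ := hS w hw
    rw [hq, hBd]
    have := aux_dual M hs hM v (Bᵀ.mulVec u)
    nlinarith [huu u, hp (Bᵀ.mulVec u), h2 v hwb]
  · intro z hz x hx
    rw [hq]
    have hk' : (1 : ℝ) ≤ k := by exact_mod_cast hk
    have h3 := aux_simplex_sq z x hz hx
    set y := Bᵀ.mulVec (z - x) with hy
    set Q := y ⬝ᵥ M.mulVec y with hQ
    have hQ0 : 0 ≤ Q := hp y
    suffices Q ≤ 8 * k by linarith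
    rcases hQ0.eq_or_lt with h0 | h0
    · rw [← h0]; linarith
    set c := Real.sqrt (1 / (2 * k * Q)) with hc
    have hc2 : c ^ 2 = 1 / (2 * k * Q) := Real.sq_sqrt (by positivity)
    have hinv : M⁻¹.mulVec (c • M.mulVec y) = c • y := by
      rw [mulVec_smul, mulVec_mulVec, Matrix.nonsing_inv_mul _ hdet, one_mulVec]
    have hb := h1 (c • M.mulVec y) (by
      rw [hinv, smul_dotProduct, dotProduct_smul, dotProduct_comm _ y, smul_eq_mul,
        smul_eq_mul, ← mul_assoc, ← sq, hc2, ← hQ]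
      apply le_of_eq
      field_simp)
    have hd := aux_simplex_dot _ z x hb hz hx
    rw [hBd, ← hy, smul_dotProduct, dotProduct_comm, smul_eq_mul, ← hQ] at hd
    have hc0 : 0 ≤ c := Real.sqrt_nonneg _
    have : (c * Q) ^ 2 ≤ 2 ^ 2 := pow_le_pow_left₀ (by positivity) hd 2
    rw [mul_pow, hc2] at this
    have he : 1 / (2 * k * Q) * Q ^ 2 = Q / (2 * k) := by field_simp
    rw [he, div_le_iff₀ (by positivity)] at this
    linarith

/-- Span of the first `t` losses. -/
def spanLt (N : ℕ) (ℓ : ℕ → Fin N → ℝ) (t : ℕ) : Submodule ℝ (Fin N → ℝ) :=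
  Submodule.span ℝ {w : Fin N → ℝ | ∃ s < t, ℓ s = w}

lemma spanLt_succ (N : ℕ) (ℓ : ℕ → Fin N → ℝ) (t : ℕ) :
    spanLt N ℓ (t + 1) = spanLt N ℓ t ⊔ Submodule.span ℝ {ℓ t} := by
  unfold spanLt
  rw [← Submodule.span_union]
  congr 1
  ext w
  simp only [Set.mem_ofPred_eq, Set.mem_union, Set.mem_singleton_iff]
  constructor
  · rintro ⟨s, hs, rfl⟩
    rcases Nat.lt_succ_iff_lt_or_eq.1 hs with h | rfl
    · exact Or.inl ⟨s, h, rfl⟩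
    · exact Or.inr rfl
  · rintro (⟨s, hs, rfl⟩ | rfl)
    · exact ⟨s, by omega, rfl⟩
    · exact ⟨t, by omega, rfl⟩

lemma spanLt_succ_not (N : ℕ) (ℓ : ℕ → Fin N → ℝ) (t : ℕ) (h : ¬ IsNovel N ℓ t) :
    spanLt N ℓ (t + 1) = spanLt N ℓ t := by
  rw [spanLt_succ, sup_eq_left, Submodule.span_singleton_le_iff_mem]
  exact not_not.1 h

lemma spanLt_succ_novel (N : ℕ) (ℓ : ℕ → Fin N → ℝ) (t : ℕ) (h : IsNovel N ℓ t) :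
    spanLt N ℓ t < spanLt N ℓ (t + 1) := by
  rw [spanLt_succ]
  refine lt_of_le_of_ne le_sup_left fun he => h ?_
  have : Submodule.span ℝ {ℓ t} ≤ spanLt N ℓ t := by rw [he]; exact le_sup_right
  exact (Submodule.span_singleton_le_iff_mem _ _).1 this

lemma spanLt_le (N : ℕ) (ℓ : ℕ → Fin N → ℝ) (S : Submodule ℝ (Fin N → ℝ)) (t : ℕ)
    (h : ∀ s < t, IsNovel N ℓ s → ℓ s ∈ S) : spanLt N ℓ t ≤ S := by
  induction t with
  | zero => simp [spanLt]
  | succ t ih =>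
    have ih := ih fun s hs => h s (by omega)
    by_cases hn : IsNovel N ℓ t
    · rw [spanLt_succ]
      exact sup_le ih ((Submodule.span_singleton_le_iff_mem _ _).2 (h t (by omega) hn))
    · rw [spanLt_succ_not _ _ _ hn]; exact ih

lemma mem_spanLt_succ (N : ℕ) (ℓ : ℕ → Fin N → ℝ) (t : ℕ) : ℓ t ∈ spanLt N ℓ (t + 1) :=
  Submodule.subset_span ⟨t, by omega, rfl⟩

lemma nc_novel (N : ℕ) (ℓ : ℕ → Fin N → ℝ) (t : ℕ) (h : IsNovel N ℓ (t + 1)) :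
    novelCount N ℓ (t + 1) = novelCount N ℓ t + 1 := by
  classical
  unfold novelCount
  rw [Finset.range_add_one, Finset.filter_insert, if_pos h, Finset.card_insert_of_notMem]
  simp

lemma nc_not (N : ℕ) (ℓ : ℕ → Fin N → ℝ) (t : ℕ) (h : ¬ IsNovel N ℓ (t + 1)) :
    novelCount N ℓ (t + 1) = novelCount N ℓ t := by
  unfold novelCount
  rw [Finset.range_add_one, Finset.filter_insert, if_neg h]

lemma nc_zero_novel (N : ℕ) (ℓ : ℕ → Fin N → ℝ) (h : IsNovel N ℓ 0) :
    novelCount N ℓ 0 = 1 := by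
  unfold novelCount
  simp [Finset.filter_singleton, h]

lemma nc_zero_not (N : ℕ) (ℓ : ℕ → Fin N → ℝ) (h : ¬ IsNovel N ℓ 0) :
    novelCount N ℓ 0 = 0 := by
  unfold novelCount
  simp [Finset.filter_singleton, h]

lemma sup_le_aux (N : ℕ) (ℓ : ℕ → Fin N → ℝ) (t : ℕ) [DecidablePred (IsNovel N ℓ)] :
    ((Finset.range (t + 1)).filter (IsNovel N ℓ)).sup id ≤ t := by
  apply Finset.sup_le
  intro s hs
  simp only [Finset.mem_filter, Finset.mem_range] at hs
  simp only [id]; omega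

lemma tau_novel (N : ℕ) (ℓ : ℕ → Fin N → ℝ) (t : ℕ) (h : IsNovel N ℓ t) :
    tauCount N ℓ t = 1 := by
  classical
  unfold tauCount
  have h1 : t ≤ ((Finset.range (t + 1)).filter (IsNovel N ℓ)).sup id :=
    Finset.le_sup (f := id) (by simp [h])
  have h2 := sup_le_aux N ℓ t
  have : ((Finset.range (t + 1)).filter (IsNovel N ℓ)).sup id = t := le_antisymm h2 h1
  convert (show t + 1 - t = 1 by omega)

lemma tau_not (N : ℕ) (ℓ : ℕ → Fin N → ℝ) (t : ℕ) (h : ¬ IsNovel N ℓ (t + 1)) :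
    tauCount N ℓ (t + 1) = tauCount N ℓ t + 1 := by
  classical
  unfold tauCount
  rw [Finset.range_add_one, Finset.filter_insert, if_neg h]
  have h2 := @sup_le_aux N ℓ t (fun _ => Classical.propDecidable _)
  omega

lemma tau_pos (N : ℕ) (ℓ : ℕ → Fin N → ℝ) (t : ℕ) : 1 ≤ tauCount N ℓ t := by
  unfold tauCount
  have h2 := @sup_le_aux N ℓ t (fun _ => Classical.propDecidable _)
  omega

lemma tau_le (N : ℕ) (ℓ : ℕ → Fin N → ℝ) (t : ℕ) : tauCount N ℓ t ≤ t + 1 := by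
  unfold tauCount; omega

lemma nc_pos_of_novel (N : ℕ) (ℓ : ℕ → Fin N → ℝ) (t : ℕ) (h : IsNovel N ℓ t) :
    1 ≤ novelCount N ℓ t := by
  cases t with
  | zero => rw [nc_zero_novel _ _ h]
  | succ t => rw [nc_novel _ _ _ h]; omega

lemma nc_le_finrank (N : ℕ) (ℓ : ℕ → Fin N → ℝ) (t : ℕ) :
    novelCount N ℓ t ≤ Module.finrank ℝ (spanLt N ℓ (t + 1)) := by
  induction t with
  | zero =>
    by_cases h : IsNovel N ℓ 0
    · have := Submodule.finrank_lt_finrank_of_lt (spanLt_succ_novel N ℓ 0 h)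
      rw [nc_zero_novel _ _ h]; omega
    · rw [nc_zero_not _ _ h]; omega
  | succ t ih =>
    by_cases h : IsNovel N ℓ (t + 1)
    · have := Submodule.finrank_lt_finrank_of_lt (spanLt_succ_novel N ℓ _ h)
      rw [nc_novel _ _ _ h]; omega
    · rw [nc_not _ _ _ h, spanLt_succ_not _ _ _ h]; exact ih

lemma loss_zero (N : ℕ) (ℓ : ℕ → Fin N → ℝ) (t : ℕ) (h : novelCount N ℓ t = 0) : ℓ t = 0 := by
  classical
  have : spanLt N ℓ (t + 1) ≤ ⊥ := by
    apply spanLt_le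
    intro s hs hn
    unfold novelCount at h
    rw [Finset.card_eq_zero, Finset.filter_eq_empty_iff] at h
    exact absurd hn (h (Finset.mem_range.2 hs))
  simpa using this (mem_spanLt_succ N ℓ t)

lemma nc_le_rank (N T : ℕ) (ℓ : ℕ → Fin N → ℝ) (t : ℕ) (ht : t < T) :
    novelCount N ℓ t ≤ (Matrix.of fun (i : Fin N) (t : Fin T) => ℓ t i).rank := by
  refine (nc_le_finrank N ℓ t).trans ?_
  rw [Matrix.rank_eq_finrank_span_cols]
  apply Submodule.finrank_mono
  apply Submodule.span_mono
  rintro w ⟨s, hs, rfl⟩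
  exact ⟨⟨s, by omega⟩, rfl⟩

/-- First-order consequence of optimality (three-point inequality). -/
lemma aux_three {N : ℕ} (H : Matrix (Fin N) (Fin N) ℝ) (hs : H.IsSymm) (c : ℝ)
    (l p y z : Fin N → ℝ) (hp : p ∈ stdSimplex ℝ (Fin N)) (hz : z ∈ stdSimplex ℝ (Fin N))
    (hmin : ∀ z ∈ stdSimplex ℝ (Fin N),
      l ⬝ᵥ p + c * ((p - y) ⬝ᵥ H.mulVec (p - y)) ≤ l ⬝ᵥ z + c * ((z - y) ⬝ᵥ H.mulVec (z - y))) :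
    l ⬝ᵥ p - l ⬝ᵥ z ≤ c * ((z - y) ⬝ᵥ H.mulVec (z - y)) - c * ((z - p) ⬝ᵥ H.mulVec (z - p))
      - c * ((y - p) ⬝ᵥ H.mulVec (y - p)) := by
  have hsym : ∀ a b : Fin N → ℝ, a ⬝ᵥ H.mulVec b = b ⬝ᵥ H.mulVec a := by
    intro a b
    rw [dotProduct_mulVec, ← mulVec_transpose, hs.eq, dotProduct_comm]
  have key : ∀ s : ℝ, 0 < s → s ≤ 1 →
      0 ≤ (l ⬝ᵥ (z - p) + 2 * c * ((z - p) ⬝ᵥ H.mulVec (p - y)))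
        + s * (c * ((z - p) ⬝ᵥ H.mulVec (z - p))) := by
    intro s h0 h1
    have hmem : p + s • (z - p) ∈ stdSimplex ℝ (Fin N) :=
      (convex_stdSimplex ℝ (Fin N)).add_smul_sub_mem hp hz ⟨h0.le, h1⟩
    have := hmin _ hmem
    rw [show p + s • (z - p) - y = (p - y) + s • (z - p) by abel] at this
    simp only [mulVec_add, mulVec_smul, dotProduct_add, add_dotProduct, smul_dotProduct,
      dotProduct_smul, smul_eq_mul, hsym (p - y) (z - p)] at this
    have h3 : 0 ≤ s * ((l ⬝ᵥ (z - p) + 2 * c * ((z - p) ⬝ᵥ H.mulVec (p - y)))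
        + s * (c * ((z - p) ⬝ᵥ H.mulVec (z - p)))) := by linarith
    exact nonneg_of_mul_nonneg_right h3 h0
  have h0 : 0 ≤ l ⬝ᵥ (z - p) + 2 * c * ((z - p) ⬝ᵥ H.mulVec (p - y)) := by
    generalize l ⬝ᵥ (z - p) + 2 * c * ((z - p) ⬝ᵥ H.mulVec (p - y)) = a at key
    generalize c * ((z - p) ⬝ᵥ H.mulVec (z - p)) = b at key
    by_contra! hneg
    have hb : 0 < |b| + 1 := by positivity
    have hpos : 0 < min 1 (-a / (2 * (|b| + 1))) := lt_min one_pos (div_pos (by linarith) (by positivity))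
    have h := key _ hpos (min_le_left _ _)
    have h5 := min_le_right 1 (-a / (2 * (|b| + 1)))
    rw [le_div_iff₀ (by positivity)] at h5
    nlinarith [le_abs_self b]
  have e1 : (z - y) = (z - p) + (p - y) := by abel
  have e2 : (y - p) = -(p - y) := by abel
  rw [e1, e2]
  simp only [mulVec_add, dotProduct_add, add_dotProduct, mulVec_neg, dotProduct_neg,
    neg_dotProduct, neg_neg, hsym (p - y) (z - p)]
  rw [dotProduct_sub] at h0
  linarith

/-- The Cauchy-type estimate used at an epoch change. -/
lemma aux_sqrt (k m τ : ℝ) (hk : 0 ≤ k) (hm : 0 ≤ m) (hτ : 0 ≤ τ) :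
    Real.sqrt (k * m) + Real.sqrt τ ≤ Real.sqrt ((k + 1) * (m + τ)) := by
  apply Real.le_sqrt_of_sq_le
  rw [Real.sqrt_mul hk]
  have h1 := Real.sq_sqrt hk
  have h2 := Real.sq_sqrt hm
  have h3 := Real.sq_sqrt hτ
  set a := Real.sqrt k
  set b := Real.sqrt m
  set c := Real.sqrt τ
  rw [← h1, ← h2, ← h3]
  nlinarith [sq_nonneg (a * c - b)]

/-- Increment of `√τ`, counted once some loss has been stored. -/
noncomputable def incr (N : ℕ) (ℓ : ℕ → Fin N → ℝ) (t : ℕ) : ℝ :=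
  if novelCount N ℓ t = 0 then 0 else
    Real.sqrt (tauCount N ℓ t) - Real.sqrt ((tauCount N ℓ t : ℝ) - 1)

lemma incr_sum_aux (N : ℕ) (ℓ : ℕ → Fin N → ℝ) (t : ℕ) :
    (novelCount N ℓ t = 0 → ∑ s ∈ Finset.range (t + 1), incr N ℓ s = 0) ∧
    (1 ≤ novelCount N ℓ t → ∑ s ∈ Finset.range (t + 1), incr N ℓ s ≤
      Real.sqrt (((novelCount N ℓ t : ℝ) - 1) * ((t : ℝ) + 1 - tauCount N ℓ t))
        + Real.sqrt (tauCount N ℓ t)) := by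
  induction t with
  | zero =>
    constructor
    · intro h; simp [incr, h]
    · intro h
      have hn : IsNovel N ℓ 0 := by
        by_contra hn
        rw [nc_zero_not _ _ hn] at h; omega
      simp [incr, nc_zero_novel _ _ hn, tau_novel _ _ _ hn]
  | succ t ih =>
    rw [Finset.sum_range_succ]
    by_cases hn : IsNovel N ℓ (t + 1)
    · constructor
      · intro h; have := nc_pos_of_novel _ _ _ hn; omega
      · intro _
        have hinc : incr N ℓ (t + 1) = 1 := by
          simp [incr, tau_novel _ _ _ hn, nc_novel _ _ _ hn]
        rw [hinc, tau_novel _ _ _ hn, nc_novel _ _ _ hn]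
        simp only [Nat.cast_one, Real.sqrt_one, Nat.cast_add, add_sub_cancel_right]
        rcases Nat.eq_zero_or_pos (novelCount N ℓ t) with h0 | h0
        · rw [ih.1 h0, h0]; simp
        · have h1 : (1 : ℝ) ≤ novelCount N ℓ t := by exact_mod_cast h0
          have h2 : (tauCount N ℓ t : ℝ) ≤ t + 1 := by exact_mod_cast tau_le N ℓ t
          have h3 := aux_sqrt ((novelCount N ℓ t : ℝ) - 1) ((t : ℝ) + 1 - tauCount N ℓ t)
            (tauCount N ℓ t) (by linarith) (by linarith) (by positivity)
          have h4 := ih.2 h0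
          rw [sub_add_cancel, sub_add_cancel] at h3
          linarith
    · have e := nc_not _ _ _ hn
      have e2 := tau_not _ _ _ hn
      rw [e, e2]
      constructor
      · intro h; rw [ih.1 h]; simp [incr, e, h]
      · intro h
        have h4 := ih.2 h
        have hinc : incr N ℓ (t + 1) = Real.sqrt ((tauCount N ℓ t : ℝ) + 1)
            - Real.sqrt (tauCount N ℓ t) := by
          have : novelCount N ℓ t ≠ 0 := by omega
          simp [incr, e, e2, this]
        rw [hinc]
        push_cast
        rw [show (t : ℝ) + 1 + 1 - (tauCount N ℓ t + 1) = t + 1 - tauCount N ℓ t by ring]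
        linarith

lemma incr_sum_le (N : ℕ) (ℓ : ℕ → Fin N → ℝ) (t d : ℕ) (hd : novelCount N ℓ t ≤ d) :
    ∑ s ∈ Finset.range (t + 1), incr N ℓ s ≤ Real.sqrt (d * ((t : ℝ) + 1)) := by
  rcases Nat.eq_zero_or_pos (novelCount N ℓ t) with h0 | h0
  · rw [(incr_sum_aux N ℓ t).1 h0]; positivity
  · refine ((incr_sum_aux N ℓ t).2 h0).trans ?_
    have h1 : (1 : ℝ) ≤ novelCount N ℓ t := by exact_mod_cast h0
    have h2 : (tauCount N ℓ t : ℝ) ≤ t + 1 := by exact_mod_cast tau_le N ℓ t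
    have h3 := aux_sqrt ((novelCount N ℓ t : ℝ) - 1) ((t : ℝ) + 1 - tauCount N ℓ t)
            (tauCount N ℓ t) (by linarith) (by linarith) (by positivity)
    rw [sub_add_cancel, sub_add_cancel] at h3
    refine h3.trans (Real.sqrt_le_sqrt ?_)
    have : (novelCount N ℓ t : ℝ) ≤ d := by exact_mod_cast hd
    gcongr

lemma incr_nonneg (N : ℕ) (ℓ : ℕ → Fin N → ℝ) (t : ℕ) : 0 ≤ incr N ℓ t := by
  unfold incr
  split_ifs
  · exact le_rfl
  · exact sub_nonneg.2 (Real.sqrt_le_sqrt (by linarith))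

/-- The inverse step size. -/
noncomputable def invStep (N : ℕ) (ℓ : ℕ → Fin N → ℝ) (t : ℕ) : ℝ :=
  (4 * Real.sqrt ((novelCount N ℓ t : ℝ) / (tauCount N ℓ t : ℝ)))⁻¹

lemma invStep_eq (N : ℕ) (ℓ : ℕ → Fin N → ℝ) (t : ℕ) :
    invStep N ℓ t = Real.sqrt (tauCount N ℓ t) / (4 * Real.sqrt (novelCount N ℓ t)) := by
  unfold invStep
  rw [Real.sqrt_div (by positivity), mul_div_assoc', inv_div]

/-- One step: stability term. -/
lemma aux_stab (a c Q : ℝ) (hc : 0 < c) (h : a ^ 2 ≤ Q) : a - c * Q ≤ 1 / (4 * c) := by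
  rw [le_div_iff₀ (by positivity)]
  nlinarith [sq_nonneg (2 * c * a - 1), mul_le_mul_of_nonneg_left h (sq_nonneg c)]

lemma aux_inc (τ : ℝ) (h : 1 ≤ τ) : 1 / Real.sqrt τ ≤ 2 * (Real.sqrt τ - Real.sqrt (τ - 1)) := by
  have h0 : 0 < Real.sqrt τ := Real.sqrt_pos.2 (by linarith)
  rw [div_le_iff₀ h0]
  have h1 := Real.sq_sqrt (show 0 ≤ τ by linarith)
  have h2 := Real.sq_sqrt (show 0 ≤ τ - 1 by linarith)
  nlinarith [sq_nonneg (Real.sqrt τ - Real.sqrt (τ - 1))]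

/-- the Online Low Rank Experts algorithm (losses indexed `0,…,T-1` here).
If the `N×T` loss matrix has rank `d` and all entries lie in `[−1,1]`, then any run of
the algorithm — `x 0 = (1/N)𝟙`; at a novel step the regularizer becomes
`H = I_N + B M Bᵀ` where the columns of `B` are exactly the stored novel losses and `M`
is any symmetric positive definite matrix whose ellipsoid sandwiches the polytope
`{v : ‖Bv‖_∞ ≤ 1}` as stated; otherwise `H` is unchanged; and
`x (t+1) = argmin_{x ∈ Δ_N} ℓ_t·x + η_t⁻¹ (x−x_t)ᵀH(x−x_t)` with `η_t = 4√(k/τ)` —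
has regret at most `8d√T`. -/
theorem stmt0 (N T d : ℕ) (hN : 1 ≤ N) (hT : 1 ≤ T) (hd : 1 ≤ d)
    (ℓ : ℕ → Fin N → ℝ)
    (hℓbound : ∀ t < T, ∀ i, |ℓ t i| ≤ 1)
    (hrank : (Matrix.of fun (i : Fin N) (t : Fin T) => ℓ t i).rank = d)
    (H : ℕ → Matrix (Fin N) (Fin N) ℝ)
    (x : ℕ → Fin N → ℝ)
    (hx0 : x 0 = fun _ => (N : ℝ)⁻¹)
    (hHnovel : ∀ t < T, IsNovel N ℓ t →
      ∃ (B : Matrix (Fin N) (Fin (novelCount N ℓ t)) ℝ)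
        (M : Matrix (Fin (novelCount N ℓ t)) (Fin (novelCount N ℓ t)) ℝ),
        (∀ j, ∃ s ≤ t, IsNovel N ℓ s ∧ (fun i => B i j) = ℓ s) ∧
        (∀ s ≤ t, IsNovel N ℓ s → ∃ j, (fun i => B i j) = ℓ s) ∧
        M.IsSymm ∧ M.PosDef ∧
        (∀ w : Fin (novelCount N ℓ t) → ℝ,
          w ⬝ᵥ M⁻¹.mulVec w ≤ 1 / (2 * (novelCount N ℓ t : ℝ)) →
          ∀ i, |B.mulVec w i| ≤ 1) ∧
        (∀ w : Fin (novelCount N ℓ t) → ℝ,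
          (∀ i, |B.mulVec w i| ≤ 1) → w ⬝ᵥ M⁻¹.mulVec w ≤ 1) ∧
        H t = 1 + B * M * Bᵀ)
    (hHold : ∀ t < T, ¬ IsNovel N ℓ t →
      H t = if t = 0 then 1 else H (t - 1))
    (hupdate : ∀ t < T, x (t + 1) ∈ stdSimplex ℝ (Fin N) ∧
      ∀ z ∈ stdSimplex ℝ (Fin N),
        ℓ t ⬝ᵥ x (t + 1) +
            (4 * Real.sqrt ((novelCount N ℓ t : ℝ) / (tauCount N ℓ t : ℝ)))⁻¹ *
              ((x (t + 1) - x t) ⬝ᵥ (H t).mulVec (x (t + 1) - x t))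
          ≤ ℓ t ⬝ᵥ z +
            (4 * Real.sqrt ((novelCount N ℓ t : ℝ) / (tauCount N ℓ t : ℝ)))⁻¹ *
              ((z - x t) ⬝ᵥ (H t).mulVec (z - x t))) :
    ∑ t ∈ Finset.range T, ℓ t ⬝ᵥ x t -
        Finset.univ.inf' (Finset.univ_nonempty_iff.mpr (Fin.pos_iff_nonempty.mp hN))
          (fun i : Fin N => ∑ t ∈ Finset.range T, ℓ t i)
      ≤ 8 * (d : ℝ) * Real.sqrt (T : ℝ) := by
  have hxs : ∀ t ≤ T, x t ∈ stdSimplex ℝ (Fin N) := by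
    intro t ht
    cases t with
    | zero =>
      rw [hx0]
      have hN' : (N : ℝ) ≠ 0 := by positivity
      exact ⟨fun i => by positivity, by simp [hN']⟩
    | succ t => exact (hupdate t (by omega)).1
  have hgood : ∀ t < T, 1 ≤ novelCount N ℓ t →
      GoodReg N (spanLt N ℓ (t + 1)) (novelCount N ℓ t) (H t) := by
    intro t
    induction t with
    | zero =>
      intro ht hk
      have hn : IsNovel N ℓ 0 := by
        by_contra hn
        rw [nc_zero_not _ _ hn] at hk; omega
      obtain ⟨B, M, hB1, hB2, hs, hM, h1, h2, hH⟩ := hHnovel 0 ht hn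
      rw [hH]
      refine aux_good hk _ B M ?_ hs hM h1 h2
      have : spanLt N ℓ (0 + 1) ≤ LinearMap.range B.mulVecLin := by
        apply spanLt_le
        intro s hs' hns
        obtain ⟨j, hj⟩ := hB2 s (by omega) hns
        exact ⟨Pi.single j 1, by rw [← hj]; ext i; simp⟩
      exact fun w hw => this hw
    | succ t ih =>
      intro ht hk
      by_cases hn : IsNovel N ℓ (t + 1)
      · obtain ⟨B, M, hB1, hB2, hs, hM, h1, h2, hH⟩ := hHnovel (t + 1) ht hn
        rw [hH]
        refine aux_good hk _ B M ?_ hs hM h1 h2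
        have : spanLt N ℓ (t + 1 + 1) ≤ LinearMap.range B.mulVecLin := by
          apply spanLt_le
          intro s hs' hns
          obtain ⟨j, hj⟩ := hB2 s (by omega) hns
          exact ⟨Pi.single j 1, by rw [← hj]; ext i; simp⟩
        exact fun w hw => this hw
      · have hH := hHold (t + 1) ht hn
        simp only [Nat.add_eq_zero_iff, one_ne_zero, and_false, if_false,
          Nat.add_sub_cancel] at hH
        rw [nc_not _ _ _ hn] at hk ⊢
        rw [hH, spanLt_succ_not _ _ _ hn]
        exact ih (by omega) hk
  have hkd : ∀ t < T, novelCount N ℓ t ≤ d := fun t ht => hrank ▸ nc_le_rank N T ℓ t ht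
  have hc0 : ∀ t, 0 ≤ invStep N ℓ t := fun t => by unfold invStep; positivity
  have hcz : ∀ t, novelCount N ℓ t = 0 → invStep N ℓ t = 0 := fun t h => by
    simp [invStep, h]
  -- main potential argument
  have main : ∀ z ∈ stdSimplex ℝ (Fin N), ∀ t ≤ T,
      ∑ s ∈ Finset.range t, (ℓ s ⬝ᵥ x s - ℓ s ⬝ᵥ z) +
        (if t = 0 then 0 else invStep N ℓ (t - 1) *
          ((z - x t) ⬝ᵥ (H (t - 1)).mulVec (z - x t)))
      ≤ (9 / 2) * Real.sqrt d * ∑ s ∈ Finset.range t, incr N ℓ s := by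
    intro z hz t
    induction t with
    | zero => intro _; simp
    | succ t ih =>
      intro ht
      have htT : t < T := by omega
      have ih := ih htT.le
      rw [Finset.sum_range_succ, Finset.sum_range_succ, if_neg (Nat.succ_ne_zero t),
        Nat.add_sub_cancel]
      set P := (if t = 0 then 0 else invStep N ℓ (t - 1) *
          ((z - x t) ⬝ᵥ (H (t - 1)).mulVec (z - x t))) with hP
      have hP0 : 0 ≤ P := by
        rw [hP]
        split_ifs with h0
        · exact le_rfl
        · rcases Nat.eq_zero_or_pos (novelCount N ℓ (t - 1)) with h | h
          · rw [hcz _ h, zero_mul]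
          · exact mul_nonneg (hc0 _) ((hgood (t - 1) (by omega) h).2.1 _)
      rcases Nat.eq_zero_or_pos (novelCount N ℓ t) with hk | hk
      · rw [hcz _ hk, loss_zero _ _ _ hk]
        have : incr N ℓ t = 0 := by simp [incr, hk]
        rw [this]
        simp only [zero_dotProduct, sub_self, zero_mul, add_zero]
        linarith
      · obtain ⟨hs, hpos, hdual, hdiam⟩ := hgood t htT hk
        have hk1 : (1 : ℝ) ≤ novelCount N ℓ t := by exact_mod_cast hk
        have hτ1 : (1 : ℝ) ≤ tauCount N ℓ t := by exact_mod_cast tau_pos N ℓ t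
        have hkd' : Real.sqrt (novelCount N ℓ t) ≤ Real.sqrt d :=
          Real.sqrt_le_sqrt (by exact_mod_cast hkd t htT)
        have hsk : 0 < Real.sqrt (novelCount N ℓ t) := Real.sqrt_pos.2 (by linarith)
        have hst : 0 < Real.sqrt (tauCount N ℓ t) := Real.sqrt_pos.2 (by linarith)
        have hk2 := Real.sq_sqrt (show (0 : ℝ) ≤ novelCount N ℓ t by linarith)
        have hinc : incr N ℓ t = Real.sqrt (tauCount N ℓ t)
            - Real.sqrt ((tauCount N ℓ t : ℝ) - 1) := by
          simp [incr, Nat.pos_iff_ne_zero.1 hk]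
        have hi0 := incr_nonneg N ℓ t
        obtain ⟨hu1, hu2⟩ := hupdate t htT
        have h3 := aux_three (H t) hs (invStep N ℓ t) (ℓ t) (x (t + 1)) (x t) z hu1 hz hu2
        have hcpos : 0 < invStep N ℓ t := by
          rw [invStep_eq]; positivity
        have h4 := aux_stab (ℓ t ⬝ᵥ (x t - x (t + 1))) (invStep N ℓ t) _ hcpos
          (hdual (ℓ t) (mem_spanLt_succ N ℓ t) (hℓbound t htT) (x t - x (t + 1)))
        rw [dotProduct_sub] at h4
        have h5 : 1 / (4 * invStep N ℓ t) ≤ 2 * Real.sqrt (novelCount N ℓ t) * incr N ℓ t := by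
          have h6 := aux_inc _ hτ1
          rw [← hinc] at h6
          have e : 1 / (4 * invStep N ℓ t)
              = Real.sqrt (novelCount N ℓ t) * (1 / Real.sqrt (tauCount N ℓ t)) := by
            rw [invStep_eq]; field_simp
          rw [e]
          nlinarith
        have hD := hdiam z hz (x t) (hxs t htT.le)
        have hD0 := hpos (z - x t)
        have h7 : invStep N ℓ t * ((z - x t) ⬝ᵥ (H t).mulVec (z - x t))
            ≤ P + 5 / 2 * Real.sqrt (novelCount N ℓ t) * incr N ℓ t := by
          have hbase : incr N ℓ t / (4 * Real.sqrt (novelCount N ℓ t)) *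
              ((z - x t) ⬝ᵥ (H t).mulVec (z - x t))
              ≤ 5 / 2 * Real.sqrt (novelCount N ℓ t) * incr N ℓ t := by
            rw [div_mul_eq_mul_div, div_le_iff₀ (by positivity)]
            have := mul_le_mul_of_nonneg_left hD hi0
            rw [← hk2] at this
            linarith
          by_cases hn : IsNovel N ℓ t
          · have hi1 : incr N ℓ t = Real.sqrt (tauCount N ℓ t) := by
              rw [hinc, tau_novel _ _ _ hn]; simp
            have : invStep N ℓ t = incr N ℓ t / (4 * Real.sqrt (novelCount N ℓ t)) := by
              rw [invStep_eq, hi1]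
            rw [this]
            linarith
          · cases t with
            | zero => rw [nc_zero_not _ _ hn] at hk; omega
            | succ t =>
              have hH := hHold (t + 1) htT hn
              simp only [Nat.add_eq_zero_iff, one_ne_zero, and_false, if_false,
                Nat.add_sub_cancel] at hH hP
              have hc : invStep N ℓ (t + 1) = invStep N ℓ t
                  + incr N ℓ (t + 1) / (4 * Real.sqrt (novelCount N ℓ (t + 1))) := by
                rw [hinc, invStep_eq, invStep_eq, nc_not _ _ _ hn, tau_not _ _ _ hn]
                push_cast
                rw [add_sub_cancel_right]
                ring
              rw [hc, add_mul, hP]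
              rw [← hH]
              linarith
        have h8 := mul_le_mul_of_nonneg_right hkd' hi0
        linarith
  obtain ⟨i, -, hi⟩ := Finset.exists_mem_eq_inf'
    (Finset.univ_nonempty_iff.mpr (Fin.pos_iff_nonempty.mp hN))
    (fun i : Fin N => ∑ t ∈ Finset.range T, ℓ t i)
  rw [hi]
  have hm := main (Pi.single i 1) (single_mem_stdSimplex ℝ i) T le_rfl
  obtain ⟨T', rfl⟩ : ∃ T', T = T' + 1 := ⟨T - 1, by omega⟩
  rw [if_neg (Nat.succ_ne_zero T'), Nat.add_sub_cancel, Finset.sum_sub_distrib] at hm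
  have hP0 : 0 ≤ invStep N ℓ T' * ((Pi.single i 1 - x (T' + 1)) ⬝ᵥ
      (H T').mulVec (Pi.single i 1 - x (T' + 1))) := by
    rcases Nat.eq_zero_or_pos (novelCount N ℓ T') with h | h
    · rw [hcz _ h, zero_mul]
    · exact mul_nonneg (hc0 _) ((hgood T' (by omega) h).2.1 _)
  simp only [dotProduct_single, mul_one] at hm
  have hsum := incr_sum_le N ℓ T' d (hkd T' (by omega))
  rw [Real.sqrt_mul (by positivity)] at hsum
  have hd2 := Real.mul_self_sqrt (show (0 : ℝ) ≤ d by positivity)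
  have h9 := mul_le_mul_of_nonneg_left hsum (Real.sqrt_nonneg (d : ℝ))
  rw [← mul_assoc, hd2] at h9
  push_cast
  have h10 : 0 ≤ (d : ℝ) * Real.sqrt ((T' : ℝ) + 1) := by positivity
  linarith
end

section
/- Let U ∈ ℝ^{d×N} have rank d (its columns u₁,…,u_N ∈ ℝ^d are the experts' embeddings), and let P = {v ∈ ℝ^d : ‖Uᵀv‖_∞ ≤ 1}. Let M be a d×d symmetric positive definite matrix satisfying {v : vᵀM⁻¹v ≤ 1/(2d)} ⊆ P ⊆ {v : vᵀM⁻¹v ≤ 1}, and set H = I_N + UᵀMU. Suppose the loss vectors satisfy ℓ_t = Uᵀv_t for some v_t ∈ ℝ^d and ‖ℓ_t‖_∞ ≤ 1 for all t = 1,…,T. Let x₁ ∈ Δ_N be arbitrary and for each t let x_{t+1} be the unique minimizer over x ∈ Δ_N of ℓ_t·x + η_t⁻¹ (x−x_t)ᵀH(x−x_t), with η_t = 4√(d/t). Then Σ_{t=1}^T x_t·ℓ_t − min_{i∈[N]} Σ_{t=1}^T ℓ_t(i) ≤ 8√(dT). -/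
open Matrix

lemma aux_lim (A C : ℝ) (h : ∀ s : ℝ, 0 < s → s ≤ 1 → 0 ≤ s * A + s ^ 2 * C) : 0 ≤ A := by
  by_contra hA
  push Not at hA
  have hC : 0 < |C| + 1 := by positivity
  have hm : 0 < min 1 (-A / (2 * (|C| + 1))) := lt_min one_pos (by apply div_pos <;> linarith)
  have h1 := h _ hm (min_le_left _ _)
  set s := min 1 (-A / (2 * (|C| + 1)))
  have h2 : s ≤ -A / (2 * (|C| + 1)) := min_le_right _ _
  rw [le_div_iff₀ (by positivity)] at h2
  have h3 : 0 ≤ s * (A + s * C) := by nlinarith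
  have h4 : 0 ≤ A + s * C := nonneg_of_mul_nonneg_right h3 hm
  have h5 : s * C ≤ s * (|C| + 1) := by
    apply mul_le_mul_of_nonneg_left _ hm.le
    linarith [le_abs_self C]
  linarith

lemma aux_sym {n : ℕ} (H : Matrix (Fin n) (Fin n) ℝ) (hH : H.IsSymm) (a b : Fin n → ℝ) :
    a ⬝ᵥ H.mulVec b = b ⬝ᵥ H.mulVec a := by
  rw [Matrix.dotProduct_mulVec, ← Matrix.mulVec_transpose, hH.eq, dotProduct_comm]

lemma aux_opt {n : ℕ} (H : Matrix (Fin n) (Fin n) ℝ) (hH : H.IsSymm) (l x y z : Fin n → ℝ)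
    (c : ℝ) (hy : y ∈ stdSimplex ℝ (Fin n)) (hz : z ∈ stdSimplex ℝ (Fin n))
    (h : ∀ w ∈ stdSimplex ℝ (Fin n), l ⬝ᵥ y + c * ((y - x) ⬝ᵥ H.mulVec (y - x)) ≤
      l ⬝ᵥ w + c * ((w - x) ⬝ᵥ H.mulVec (w - x))) :
    l ⬝ᵥ y - l ⬝ᵥ z ≤ c * ((z - x) ⬝ᵥ H.mulVec (z - x) - (z - y) ⬝ᵥ H.mulVec (z - y)
      - (y - x) ⬝ᵥ H.mulVec (y - x)) := by
  have hs := aux_sym H hH (y - x) (z - y)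
  have key : 0 ≤ l ⬝ᵥ (z - y) + 2 * c * ((y - x) ⬝ᵥ H.mulVec (z - y)) := by
    apply aux_lim _ (c * ((z - y) ⬝ᵥ H.mulVec (z - y)))
    intro s s0 s1
    have hw := h (y + s • (z - y)) ((convex_stdSimplex ℝ (Fin n)).add_smul_sub_mem hy hz ⟨s0.le, s1⟩)
    have e : y + s • (z - y) - x = (y - x) + s • (z - y) := by abel
    rw [e] at hw
    simp only [mulVec_add, mulVec_smul, dotProduct_add, add_dotProduct, dotProduct_smul,
      smul_dotProduct, smul_eq_mul] at hw
    rw [← hs] at hw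
    nlinarith
  have e : z - x = (y - x) + (z - y) := by abel
  rw [e, mulVec_add, dotProduct_add, add_dotProduct, add_dotProduct, ← hs]
  rw [dotProduct_sub] at key
  nlinarith

lemma aux_H {d N : ℕ} (U : Matrix (Fin d) (Fin N) ℝ) (M : Matrix (Fin d) (Fin d) ℝ)
    (w : Fin N → ℝ) : w ⬝ᵥ (1 + Uᵀ * M * U).mulVec w =
      w ⬝ᵥ w + (U.mulVec w) ⬝ᵥ M.mulVec (U.mulVec w) := by
  rw [add_mulVec, one_mulVec, dotProduct_add, ← mulVec_mulVec, ← mulVec_mulVec,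
    dotProduct_mulVec w Uᵀ, vecMul_transpose]

lemma aux_psd {d : ℕ} (M : Matrix (Fin d) (Fin d) ℝ) (hM : M.PosDef) (p : Fin d → ℝ) :
    0 ≤ p ⬝ᵥ M.mulVec p := by
  simpa using hM.posSemidef.dotProduct_mulVec_nonneg p

lemma aux_diam {d N : ℕ} (hd : 0 < d) (U : Matrix (Fin d) (Fin N) ℝ)
    (M : Matrix (Fin d) (Fin d) ℝ) (hMsym : M.IsSymm) (hMpd : M.PosDef)
    (hM1 : ∀ v : Fin d → ℝ, v ⬝ᵥ M⁻¹.mulVec v ≤ 1 / (2 * (d : ℝ)) →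
      ∀ i, |Uᵀ.mulVec v i| ≤ 1) (a : Fin N → ℝ) (ha : a ∈ stdSimplex ℝ (Fin N)) :
    (U.mulVec a) ⬝ᵥ M.mulVec (U.mulVec a) ≤ 2 * d := by
  have hd' : (0:ℝ) < d := by exact_mod_cast hd
  set p := U.mulVec a with hp
  set r := p ⬝ᵥ M.mulVec p with hr
  rcases le_or_gt r 0 with h0 | h0
  · linarith
  have hdet : IsUnit M.det := (Matrix.isUnit_iff_isUnit_det _).1 hMpd.isUnit
  set s := (Real.sqrt (2 * d * r))⁻¹ with hs
  have hq : 0 < Real.sqrt (2 * d * r) := Real.sqrt_pos.2 (by positivity)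
  have hqq : Real.sqrt (2 * d * r) * Real.sqrt (2 * d * r) = 2 * d * r :=
    Real.mul_self_sqrt (by positivity)
  have h1 := hM1 (s • M.mulVec p) (by
    rw [mulVec_smul, mulVec_mulVec p M⁻¹ M, nonsing_inv_mul _ hdet, one_mulVec, dotProduct_smul,
      smul_dotProduct, dotProduct_comm, ← hr, smul_eq_mul, smul_eq_mul, hs, ← mul_assoc,
      ← mul_inv, hqq]
    apply le_of_eq
    field_simp)
  have h2 : a ⬝ᵥ Uᵀ.mulVec (s • M.mulVec p) ≤ 1 := by
    calc a ⬝ᵥ Uᵀ.mulVec (s • M.mulVec p) ≤ ∑ i, a i := by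
          unfold dotProduct
          apply Finset.sum_le_sum
          intro i _
          have := (abs_le.1 (h1 i)).2
          nlinarith [ha.1 i]
      _ = 1 := ha.2
  rw [dotProduct_mulVec, vecMul_transpose, ← hp, dotProduct_smul, ← hr, smul_eq_mul, hs,
    inv_mul_le_iff₀ hq, mul_one] at h2
  have : r * r ≤ 2 * d * r := by nlinarith
  exact le_of_mul_le_mul_right this h0

lemma aux_self {N : ℕ} (a : Fin N → ℝ) (ha : a ∈ stdSimplex ℝ (Fin N)) : a ⬝ᵥ a ≤ 1 := by
  rw [← ha.2]
  unfold dotProduct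
  apply Finset.sum_le_sum
  intro i _
  have h1 : a i ≤ 1 := by
    rw [← ha.2]; exact Finset.single_le_sum (fun j _ => ha.1 j) (Finset.mem_univ i)
  nlinarith [ha.1 i]

lemma aux_par {n : ℕ} (H : Matrix (Fin n) (Fin n) ℝ) (h : ∀ w, 0 ≤ w ⬝ᵥ H.mulVec w)
    (a b : Fin n → ℝ) : (a - b) ⬝ᵥ H.mulVec (a - b) ≤
      2 * (a ⬝ᵥ H.mulVec a) + 2 * (b ⬝ᵥ H.mulVec b) := by
  have := h (a + b)
  simp only [mulVec_add, mulVec_sub, dotProduct_add, add_dotProduct, dotProduct_sub,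
    sub_dotProduct] at *
  linarith

lemma aux_cs_s2 {d : ℕ} (M : Matrix (Fin d) (Fin d) ℝ) (hMsym : M.IsSymm) (hMpd : M.PosDef)
    (v p : Fin d → ℝ) (hv : v ⬝ᵥ M⁻¹.mulVec v ≤ 1) (c : ℝ) (hc : 0 < c) :
    v ⬝ᵥ p ≤ c⁻¹ / 4 + c * (p ⬝ᵥ M.mulVec p) := by
  have hdet : IsUnit M.det := (Matrix.isUnit_iff_isUnit_det _).1 hMpd.isUnit
  set y := M⁻¹.mulVec v with hy
  have hMy : M.mulVec y = v := by
    rw [hy, mulVec_mulVec, mul_nonsing_inv _ hdet, one_mulVec]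
  have h := aux_psd M hMpd ((c⁻¹ / 2) • y - p)
  have hs := aux_sym M hMsym y p
  rw [mulVec_sub, mulVec_smul, hMy] at h
  rw [hMy] at hs
  simp only [dotProduct_sub, sub_dotProduct, dotProduct_smul, smul_dotProduct, smul_eq_mul,
    hs, dotProduct_comm p v] at h
  rw [dotProduct_comm y v] at h
  have h2 : c⁻¹ * (v ⬝ᵥ p) ≤ c⁻¹ ^ 2 / 4 + p ⬝ᵥ M.mulVec p := by
    nlinarith [sq_nonneg c⁻¹]
  have h3 := mul_le_mul_of_nonneg_left h2 hc.le
  have e : c * c⁻¹ = 1 := mul_inv_cancel₀ hc.ne'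
  calc v ⬝ᵥ p = c * (c⁻¹ * (v ⬝ᵥ p)) := by rw [← mul_assoc, e, one_mul]
    _ ≤ _ := h3
    _ = (c * c⁻¹) * c⁻¹ / 4 + c * (p ⬝ᵥ M.mulVec p) := by ring
    _ = _ := by rw [e, one_mul]

/-- OMD with a known subspace. `U ∈ ℝ^{d×N}` of rank `d` (columns are the
experts' embeddings), `P = {v : ‖Uᵀv‖_∞ ≤ 1}`, `M` symmetric positive definite with
`{v : vᵀM⁻¹v ≤ 1/(2d)} ⊆ P ⊆ {v : vᵀM⁻¹v ≤ 1}`, regularizer `H = I_N + UᵀMU`, losses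
`ℓ_t = Uᵀv_t` with `‖ℓ_t‖_∞ ≤ 1`, step sizes `η_t = 4√(d/t)` (round `t` is index `t-1`
here), and mirror-descent iterates over the simplex.  Then the regret is at most
`8√(dT)`. -/
theorem stmt2 (N T d : ℕ) (hN : 0 < N) (hT : 0 < T) (hd : 0 < d)
    (U : Matrix (Fin d) (Fin N) ℝ) (hU : U.rank = d)
    (M : Matrix (Fin d) (Fin d) ℝ) (hMsym : M.IsSymm) (hMpd : M.PosDef)
    (hM1 : ∀ v : Fin d → ℝ, v ⬝ᵥ M⁻¹.mulVec v ≤ 1 / (2 * (d : ℝ)) →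
      ∀ i, |Uᵀ.mulVec v i| ≤ 1)
    (hM2 : ∀ v : Fin d → ℝ, (∀ i, |Uᵀ.mulVec v i| ≤ 1) → v ⬝ᵥ M⁻¹.mulVec v ≤ 1)
    (ℓ : ℕ → Fin N → ℝ) (v : ℕ → Fin d → ℝ)
    (hℓv : ∀ t < T, ℓ t = Uᵀ.mulVec (v t))
    (hℓbound : ∀ t < T, ∀ i, |ℓ t i| ≤ 1)
    (x : ℕ → Fin N → ℝ) (hx0 : x 0 ∈ stdSimplex ℝ (Fin N))
    (hupdate : ∀ t < T, x (t + 1) ∈ stdSimplex ℝ (Fin N) ∧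
      ∀ z ∈ stdSimplex ℝ (Fin N),
        ℓ t ⬝ᵥ x (t + 1) + (4 * Real.sqrt ((d : ℝ) / ((t : ℝ) + 1)))⁻¹ *
            ((x (t + 1) - x t) ⬝ᵥ (1 + Uᵀ * M * U).mulVec (x (t + 1) - x t))
          ≤ ℓ t ⬝ᵥ z + (4 * Real.sqrt ((d : ℝ) / ((t : ℝ) + 1)))⁻¹ *
            ((z - x t) ⬝ᵥ (1 + Uᵀ * M * U).mulVec (z - x t))) :
    ∑ t ∈ Finset.range T, ℓ t ⬝ᵥ x t -
        Finset.univ.inf' (Finset.univ_nonempty_iff.mpr (Fin.pos_iff_nonempty.mp hN))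
          (fun i : Fin N => ∑ t ∈ Finset.range T, ℓ t i)
      ≤ 8 * Real.sqrt ((d : ℝ) * (T : ℝ)) := by
  have hd' : (0:ℝ) < d := by exact_mod_cast hd
  have hd1 : (1:ℝ) ≤ d := by exact_mod_cast hd
  have hsd : 0 < Real.sqrt d := Real.sqrt_pos.2 hd'
  have hsd2 : Real.sqrt d * Real.sqrt d = d := Real.mul_self_sqrt hd'.le
  have hHs : (1 + Uᵀ * M * U).IsSymm := by
    unfold Matrix.IsSymm
    rw [transpose_add, transpose_one, transpose_mul, transpose_mul, transpose_transpose,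
      hMsym.eq, Matrix.mul_assoc]
  have hww : ∀ w : Fin N → ℝ, 0 ≤ w ⬝ᵥ w := fun w =>
    Finset.sum_nonneg fun i _ => mul_self_nonneg _
  have hH0 : ∀ w, 0 ≤ w ⬝ᵥ (1 + Uᵀ * M * U).mulVec w := by
    intro w
    rw [aux_H]
    exact add_nonneg (hww w) (aux_psd M hMpd _)
  have hHa : ∀ a ∈ stdSimplex ℝ (Fin N), a ⬝ᵥ (1 + Uᵀ * M * U).mulVec a ≤ 3 * d := by
    intro a ha
    rw [aux_H]
    linarith [aux_self a ha, aux_diam hd U M hMsym hMpd hM1 a ha]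
  have hxm : ∀ t ≤ T, x t ∈ stdSimplex ℝ (Fin N) := by
    intro t ht
    cases t with
    | zero => exact hx0
    | succ t => exact (hupdate t ht).1
  obtain ⟨i, -, hi⟩ := Finset.exists_mem_eq_inf'
    (Finset.univ_nonempty_iff.mpr (Fin.pos_iff_nonempty.mp hN))
    (fun i : Fin N => ∑ t ∈ Finset.range T, ℓ t i)
  rw [hi, ← Finset.sum_sub_distrib]
  set z : Fin N → ℝ := Pi.single i 1 with hz
  have hzm : z ∈ stdSimplex ℝ (Fin N) := single_mem_stdSimplex ℝ i
  have hlz : ∀ t, ℓ t i = ℓ t ⬝ᵥ z := by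
    intro t; rw [hz, dotProduct_single, mul_one]
  set q : ℕ → ℝ := fun t => (z - x t) ⬝ᵥ (1 + Uᵀ * M * U).mulVec (z - x t) with hq
  have hqD : ∀ t ≤ T, q t ≤ 12 * d := by
    intro t ht
    have := aux_par _ hH0 z (x t)
    simp only [hq]
    linarith [hHa z hzm, hHa _ (hxm t ht)]
  have hq0 : ∀ t, 0 ≤ q t := fun t => hH0 _
  have main : ∀ n ≤ T, ∑ t ∈ Finset.range n, (ℓ t ⬝ᵥ x t - ℓ t i) ≤
      2 * Real.sqrt d * Real.sqrt n + Real.sqrt n / (4 * Real.sqrt d) * (12 * d - q n) := by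
    intro n
    induction n with
    | zero => intro _; simp
    | succ n ih =>
      intro hn
      have hnT : n < T := hn
      have ih := ih hnT.le
      rw [Finset.sum_range_succ]
      obtain ⟨hm, ho⟩ := hupdate n hnT
      have hn1 : (0:ℝ) < (n:ℝ) + 1 := by positivity
      have hsn : 0 < Real.sqrt ((n:ℝ) + 1) := Real.sqrt_pos.2 hn1
      have hsn2 : Real.sqrt ((n:ℝ) + 1) * Real.sqrt ((n:ℝ) + 1) = n + 1 :=
        Real.mul_self_sqrt hn1.le
      have hsm0 := Real.sqrt_nonneg (n:ℝ)
      have hsm2 : Real.sqrt (n:ℝ) * Real.sqrt n = n := Real.mul_self_sqrt (Nat.cast_nonneg n)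
      have hle : Real.sqrt (n:ℝ) ≤ Real.sqrt ((n:ℝ) + 1) := Real.sqrt_le_sqrt (by linarith)
      have hce : (4 * Real.sqrt ((d : ℝ) / ((n : ℝ) + 1)))⁻¹ =
          Real.sqrt ((n:ℝ) + 1) / (4 * Real.sqrt d) := by
        rw [Real.sqrt_div hd'.le]
        field_simp
      rw [hce] at ho
      have h1 := aux_opt _ hHs (ℓ n) (x n) (x (n+1)) z _ hm hzm ho
      have hc : 0 < Real.sqrt ((n:ℝ) + 1) / (4 * Real.sqrt d) := by positivity
      have hv : v n ⬝ᵥ M⁻¹.mulVec (v n) ≤ 1 := by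
        apply hM2
        rw [← hℓv n hnT]
        exact hℓbound n hnT
      have h2 := aux_cs_s2 M hMsym hMpd (v n) (U.mulVec (x n - x (n+1))) hv _ hc
      have e1 : v n ⬝ᵥ U.mulVec (x n - x (n+1)) = ℓ n ⬝ᵥ x n - ℓ n ⬝ᵥ x (n+1) := by
        rw [hℓv n hnT, dotProduct_mulVec, ← mulVec_transpose, dotProduct_sub]
      have e2 : (U.mulVec (x n - x (n+1))) ⬝ᵥ M.mulVec (U.mulVec (x n - x (n+1))) ≤
          (x (n+1) - x n) ⬝ᵥ (1 + Uᵀ * M * U).mulVec (x (n+1) - x n) := by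
        rw [aux_H, ← neg_sub (x (n+1)) (x n)]
        simp only [mulVec_neg, neg_dotProduct, dotProduct_neg, neg_neg]
        linarith [hww (x (n+1) - x n)]
      have e3 := mul_le_mul_of_nonneg_left e2 hc.le
      rw [e1] at h2
      have e4 : (Real.sqrt ((n:ℝ) + 1) / (4 * Real.sqrt d))⁻¹ / 4 ≤
          2 * Real.sqrt d * Real.sqrt ((n:ℝ)+1) - 2 * Real.sqrt d * Real.sqrt n := by
        have : (Real.sqrt ((n:ℝ) + 1) / (4 * Real.sqrt d))⁻¹ / 4 =
          Real.sqrt d / Real.sqrt ((n:ℝ) + 1) := by field_simp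
        rw [this, div_le_iff₀ hsn]
        have : 1 ≤ (2 * Real.sqrt ((n:ℝ)+1) - 2 * Real.sqrt n) * Real.sqrt ((n:ℝ)+1) := by
          nlinarith [sq_nonneg (Real.sqrt ((n:ℝ)+1) - Real.sqrt n)]
        nlinarith
      have e5 : Real.sqrt n / (4 * Real.sqrt d) * (12 * d - q n) ≤
          Real.sqrt ((n:ℝ)+1) / (4 * Real.sqrt d) * (12 * d - q n) := by
        apply mul_le_mul_of_nonneg_right _ (by linarith [hqD n hnT.le])
        gcongr
      rw [hlz n]
      push_cast
      change ℓ n ⬝ᵥ x (n+1) - ℓ n ⬝ᵥ z ≤ _ * (q n - q (n+1) - _) at h1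
      generalize Real.sqrt ((n:ℝ) + 1) / (4 * Real.sqrt d) = c at *
      linarith
  have hf := main T le_rfl
  have hsT := Real.sqrt_nonneg (T:ℝ)
  have h3 : Real.sqrt T / (4 * Real.sqrt d) * (12 * d - q T) ≤
      Real.sqrt T / (4 * Real.sqrt d) * (12 * d) := by
    apply mul_le_mul_of_nonneg_left _ (by positivity)
    linarith [hq0 T]
  have h4 : Real.sqrt T / (4 * Real.sqrt d) * (12 * d) = 3 * Real.sqrt d * Real.sqrt T := by
    nth_rewrite 2 [← hsd2]
    field_simp
    norm_num
  rw [Real.sqrt_mul hd'.le]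
  have := mul_nonneg hsd.le hsT
  linarith
end

section
/- Let K ⊆ ℝ^d be a compact convex set, symmetric about the origin (K = −K), with nonempty interior, and let K* = {x ∈ ℝ^d : |y·x| ≤ 1 for all y ∈ K} be its dual set. Let α > 0, let ℓ₁,…,ℓ_t ∈ K, and let F ⊆ αK* = {αx : x ∈ K*} be a nonempty set of vectors. Then the Rademacher average satisfies 2^{−t} Σ_{σ ∈ {−1,1}^t} sup_{w ∈ F} (1/t) Σ_{i=1}^t σ_i (w·ℓ_i) ≤ α√(d/t). -/
open Matrix Pointwise

/-- Symmetric positive semidefinite matrices whose quadratic form is at most one on `K`. -/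
def JohnSet {d : ℕ} (K : Set (Fin d → ℝ)) : Set (Matrix (Fin d) (Fin d) ℝ) :=
  {M | Mᵀ = M ∧ (∀ x, 0 ≤ x ⬝ᵥ M *ᵥ x) ∧ ∀ x ∈ K, x ⬝ᵥ M *ᵥ x ≤ 1}

theorem john_symm {d : ℕ} {M : Matrix (Fin d) (Fin d) ℝ} (h : Mᵀ = M) (x y : Fin d → ℝ) :
    x ⬝ᵥ M *ᵥ y = y ⬝ᵥ M *ᵥ x := by
  rw [dotProduct_mulVec, dotProduct_comm, ← mulVec_transpose, h]

theorem john_closed {d : ℕ} (K : Set (Fin d → ℝ)) : IsClosed (JohnSet K) := by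
  have hc : ∀ x : Fin d → ℝ,
      Continuous (fun M : Matrix (Fin d) (Fin d) ℝ => x ⬝ᵥ M *ᵥ x) := by
    intro x
    fun_prop
  have h1 : IsClosed {M : Matrix (Fin d) (Fin d) ℝ | Mᵀ = M} :=
    isClosed_eq (by fun_prop) continuous_id
  have h2 : IsClosed {M : Matrix (Fin d) (Fin d) ℝ | ∀ x, 0 ≤ x ⬝ᵥ M *ᵥ x} := by
    simp only [Set.ofPred_forall]
    exact isClosed_iInter fun x => isClosed_le continuous_const (hc x)
  have h3 : IsClosed {M : Matrix (Fin d) (Fin d) ℝ | ∀ x ∈ K, x ⬝ᵥ M *ᵥ x ≤ 1} := by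
    simp only [Set.ofPred_forall]
    exact isClosed_iInter fun x => isClosed_iInter fun _ => isClosed_le (hc x) continuous_const
  exact h1.inter (h2.inter h3)

theorem john_zero_mem {d : ℕ} (K : Set (Fin d → ℝ)) (hKconv : Convex ℝ K)
    (hKsymm : K = -K) (hKint : (interior K).Nonempty) :
    ∃ r : ℝ, 0 < r ∧ ∀ i, Pi.single i r ∈ K := by
  obtain ⟨p, hp⟩ := hKint
  have hp' : -p ∈ interior K := by
    have h1 := (Homeomorph.neg (Fin d → ℝ)).preimage_interior K
    have h2 : (Homeomorph.neg (Fin d → ℝ)) ⁻¹' K = K := hKsymm.symm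
    rw [h2] at h1
    have h3 : p ∈ (Homeomorph.neg (Fin d → ℝ)) ⁻¹' interior K := by rw [h1]; exact hp
    exact h3
  have h0 : (0 : Fin d → ℝ) ∈ interior K := by
    have := hKconv.interior hp hp' (a := 1/2) (b := 1/2) (by norm_num) (by norm_num) (by norm_num)
    simpa using this
  obtain ⟨r, hr, hb⟩ := Metric.mem_nhds_iff.1 (mem_interior_iff_mem_nhds.1 h0)
  refine ⟨r/2, by positivity, fun i => hb ?_⟩
  rw [mem_ball_zero_iff, Pi.norm_single, Real.norm_eq_abs, abs_of_pos (by positivity)]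
  linarith

theorem john_compact {d : ℕ} (K : Set (Fin d → ℝ)) (hKconv : Convex ℝ K)
    (hKsymm : K = -K) (hKint : (interior K).Nonempty) : IsCompact (JohnSet K) := by
  obtain ⟨r, hr, hK⟩ := john_zero_mem K hKconv hKsymm hKint
  have hcomp : IsCompact (Set.univ.pi fun _ : Fin d => Set.univ.pi fun _ : Fin d =>
      Set.Icc (-(1/r^2)) (1/r^2)) :=
    isCompact_univ_pi fun _ => isCompact_univ_pi fun _ => isCompact_Icc
  refine IsCompact.of_isClosed_subset hcomp (john_closed K) ?_
  rintro M ⟨hs, hp, h1⟩ i - j -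
  have hd : ∀ i, M i i ≤ 1/r^2 := by
    intro i
    have := h1 _ (hK i)
    simp only [single_dotProduct, mulVec_single, Pi.smul_apply] at this
    simp at this
    rw [le_div_iff₀ (by positivity)]
    nlinarith
  have hsym : M j i = M i j := congrFun (congrFun hs i) j
  have ha := hp (Pi.single i 1 + Pi.single j 1)
  have hb := hp (Pi.single i 1 - Pi.single j 1)
  simp [mulVec_add, mulVec_sub, add_dotProduct, sub_dotProduct] at ha hb
  have := hd i
  have := hd j
  constructor <;> linarith

theorem john_max {d : ℕ} (K : Set (Fin d → ℝ)) (hKconv : Convex ℝ K) (hKcomp : IsCompact K)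
    (hKsymm : K = -K) (hKint : (interior K).Nonempty) :
    ∃ M ∈ JohnSet K, 0 < M.det ∧ ∀ N ∈ JohnSet K, N.det ≤ M.det := by
  obtain ⟨B, hB⟩ := (hKcomp.image (f := fun x : Fin d → ℝ => x ⬝ᵥ x) (by fun_prop)).bddAbove
  have hB' : ∀ x ∈ K, x ⬝ᵥ x ≤ B := fun x hx => hB ⟨x, hx, rfl⟩
  have hnn : ∀ x : Fin d → ℝ, 0 ≤ x ⬝ᵥ x := fun x =>
    Finset.sum_nonneg fun i _ => mul_self_nonneg (x i)
  have hB0 : 0 ≤ B := by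
    obtain ⟨p, hp⟩ := hKint
    exact (hnn p).trans (hB' p (interior_subset hp))
  have hmem : ((B + 1)⁻¹ • (1 : Matrix (Fin d) (Fin d) ℝ)) ∈ JohnSet K := by
    refine ⟨by simp, fun x => ?_, fun x hx => ?_⟩
    · have := hnn x
      simp only [smul_mulVec, one_mulVec, dotProduct_smul, smul_eq_mul]
      positivity
    · simp only [smul_mulVec, one_mulVec, dotProduct_smul, smul_eq_mul]
      rw [inv_mul_le_iff₀ (by positivity)]
      linarith [hB' x hx]
  obtain ⟨M, hM, hmax⟩ := (john_compact K hKconv hKsymm hKint).exists_isMaxOn ⟨_, hmem⟩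
    (f := fun M : Matrix (Fin d) (Fin d) ℝ => M.det) (by fun_prop)
  refine ⟨M, hM, lt_of_lt_of_le ?_ (hmax hmem), fun N hN => hmax hN⟩
  simp only [det_smul, det_one]
  positivity

theorem john_scalar {d : ℕ} {q : ℝ} (h : ∀ u : ℝ, 0 < u → 1 + u * q ≤ (1 + u) ^ d) :
    q ≤ d := by
  by_contra! hq
  have hd : (0 : ℝ) ≤ d := Nat.cast_nonneg d
  have hq0 : 0 < q := lt_of_le_of_lt hd hq
  set D : ℝ := (d : ℝ) with hD
  have hqd : 0 ≤ q * D := by positivity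
  set u : ℝ := (q - D) / (2 * (q * D) + 1) with hu
  have hu0 : 0 < u := div_pos (by linarith) (by positivity)
  have hu1 : u * (2 * (q * D) + 1) = q - D := by
    rw [hu]; field_simp
  have h1 := h u hu0
  have h2 : (1 + u) ^ d ≤ Real.exp (u * D) := by
    rw [mul_comm, hD, Real.exp_nat_mul]
    exact pow_le_pow_left₀ (by positivity) (by linarith [Real.add_one_le_exp u]) d
  have h3 : 1 - u * D ≤ Real.exp (-(u * D)) := by
    linarith [Real.add_one_le_exp (-(u * D))]
  have h4 : Real.exp (u * D) * Real.exp (-(u * D)) = 1 := by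
    rw [← Real.exp_add]; simp
  have h5 : (1 + u * q) * (1 - u * D) ≤ 1 := by
    calc (1 + u * q) * (1 - u * D) ≤ (1 + u * q) * Real.exp (-(u * D)) := by gcongr
      _ ≤ Real.exp (u * D) * Real.exp (-(u * D)) := by gcongr; linarith
      _ = 1 := h4
  have h6 : u * (q - D - u * (q * D)) ≤ 0 := by nlinarith
  have h7 : 0 < q - D - u * (q * D) := by rw [← hu1]; nlinarith [mul_nonneg hu0.le hqd]
  nlinarith [mul_pos hu0 h7]

theorem john_exists {d : ℕ} (K : Set (Fin d → ℝ)) (hKconv : Convex ℝ K) (hKcomp : IsCompact K)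
    (hKsymm : K = -K) (hKint : (interior K).Nonempty) :
    ∃ M ∈ JohnSet K, ∀ w : Fin d → ℝ, (∀ y ∈ K, |w ⬝ᵥ y| ≤ 1) →
      ∀ x, (w ⬝ᵥ x) ^ 2 ≤ d * (x ⬝ᵥ M *ᵥ x) := by
  obtain ⟨M, hM, hdet, hmax⟩ := john_max K hKconv hKcomp hKsymm hKint
  refine ⟨M, hM, fun w hw x => ?_⟩
  obtain ⟨hs, hp, h1⟩ := hM
  set z := M⁻¹ *ᵥ w with hz
  have hMz : M *ᵥ z = w := by
    rw [hz, mulVec_mulVec, mul_nonsing_inv _ (isUnit_iff_ne_zero.2 hdet.ne'), one_mulVec]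
  have hq : w ⬝ᵥ z ≤ d := by
    apply john_scalar
    intro u hu
    have hquad : ∀ x, x ⬝ᵥ ((1 + u)⁻¹ • (M + u • vecMulVec w w)) *ᵥ x
        = (1 + u)⁻¹ * (x ⬝ᵥ M *ᵥ x + u * (w ⬝ᵥ x) ^ 2) := by
      intro x
      simp only [smul_mulVec, add_mulVec, vecMulVec_mulVec, dotProduct_smul, dotProduct_add,
        smul_eq_mul, op_smul_eq_smul]
      rw [dotProduct_comm x w]
      ring
    have hN : ((1 + u)⁻¹ • (M + u • vecMulVec w w)) ∈ JohnSet K := by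
      refine ⟨?_, fun x => ?_, fun x hx => ?_⟩
      · simp [hs, transpose_vecMulVec]
      · rw [hquad]
        have := hp x
        positivity
      · rw [hquad, inv_mul_le_iff₀ (by positivity)]
        have := h1 x hx
        have h2 : (w ⬝ᵥ x) ^ 2 ≤ 1 := by
          rw [← sq_abs]; exact pow_le_one₀ (abs_nonneg _) (hw x hx)
        nlinarith
    have h2 := hmax _ hN
    have hfac : M + u • vecMulVec w w = M * (1 + vecMulVec (u • z) w) := by
      rw [mul_add, mul_one, mul_vecMulVec, mulVec_smul, hMz, smul_vecMulVec]
    rw [det_smul, hfac, det_mul, vecMulVec_eq Unit,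
      det_one_add_replicateCol_mul_replicateRow, dotProduct_smul, smul_eq_mul,
      Fintype.card_fin, inv_pow, inv_mul_le_iff₀ (by positivity), mul_comm] at h2
    exact le_of_mul_le_mul_right h2 hdet
  have hX := hp x
  have hzz : z ⬝ᵥ M *ᵥ z = w ⬝ᵥ z := by rw [hMz, dotProduct_comm]
  have hxz : x ⬝ᵥ M *ᵥ z = w ⬝ᵥ x := by rw [hMz, dotProduct_comm]
  have hzx : z ⬝ᵥ M *ᵥ x = w ⬝ᵥ x := by rw [john_symm hs, hxz]
  have hdisc := discrim_le_zero (a := x ⬝ᵥ M *ᵥ x) (b := 2 * (w ⬝ᵥ x)) (c := w ⬝ᵥ z) (by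
    intro s
    have := hp (s • x + z)
    simp only [mulVec_add, mulVec_smul, add_dotProduct, dotProduct_add, smul_dotProduct,
      dotProduct_smul, smul_eq_mul, hzz, hxz, hzx] at this
    nlinarith)
  rw [discrim] at hdisc
  nlinarith [mul_le_mul_of_nonneg_right hq hX]

/-- The Rademacher sign of a Boolean. -/
def rsgn (b : Bool) : ℝ := if b then 1 else -1

theorem rad_orth {t : ℕ} (i j : Fin t) :
    ∑ σ : Fin t → Bool, rsgn (σ i) * rsgn (σ j) = if i = j then (2 : ℝ) ^ t else 0 := by
  split_ifs with h
  · subst h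
    have : ∀ b, rsgn b * rsgn b = 1 := by intro b; cases b <;> simp [rsgn]
    simp [this]
  · refine Finset.sum_involution (fun σ _ => Function.update σ i (!σ i)) ?_ ?_ ?_ ?_
    · intro σ _
      rw [Function.update_self, Function.update_of_ne (Ne.symm h)]
      cases σ i <;> cases σ j <;> simp [rsgn]
    · intro σ _ _ he
      have := congrFun he i
      simp at this
    · simp
    · intro σ _
      simp

theorem rad_quad {d t : ℕ} (M : Matrix (Fin d) (Fin d) ℝ) (ℓ : Fin t → Fin d → ℝ) :
    ∑ σ : Fin t → Bool, (∑ i, rsgn (σ i) • ℓ i) ⬝ᵥ M *ᵥ (∑ i, rsgn (σ i) • ℓ i)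
      = 2 ^ t * ∑ i, ℓ i ⬝ᵥ M *ᵥ ℓ i := by
  have : ∀ σ : Fin t → Bool, (∑ i, rsgn (σ i) • ℓ i) ⬝ᵥ M *ᵥ (∑ i, rsgn (σ i) • ℓ i)
      = ∑ i, ∑ j, (rsgn (σ i) * rsgn (σ j)) * (ℓ i ⬝ᵥ M *ᵥ ℓ j) := by
    intro σ
    rw [mulVec_sum, sum_dotProduct]
    refine Finset.sum_congr rfl fun i _ => ?_
    rw [dotProduct_sum]
    refine Finset.sum_congr rfl fun j _ => ?_
    rw [mulVec_smul, smul_dotProduct, dotProduct_smul, smul_eq_mul, smul_eq_mul, mul_assoc]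
  simp_rw [this]
  rw [Finset.sum_comm, Finset.mul_sum]
  refine Finset.sum_congr rfl fun i _ => ?_
  rw [Finset.sum_comm]
  simp_rw [← Finset.sum_mul, rad_orth]
  simp

/-- Rademacher complexity bound via John's theorem. `K ⊆ ℝ^d` a compact
symmetric convex body with nonempty interior, `K*` its dual set, `α > 0`,
`ℓ_1,…,ℓ_t ∈ K`, and `F ⊆ αK*` a nonempty set of linear functionals. Then
`2^{−t} Σ_{σ∈{−1,1}^t} sup_{w∈F} (1/t) Σ_i σ_i (w·ℓ_i) ≤ α√(d/t)`. -/
theorem stmt6 (d t : ℕ) (ht : 0 < t)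
    (K : Set (Fin d → ℝ)) (hKconv : Convex ℝ K) (hKcomp : IsCompact K)
    (hKsymm : K = -K) (hKint : (interior K).Nonempty)
    (α : ℝ) (hα : 0 < α)
    (ℓ : Fin t → Fin d → ℝ) (hℓ : ∀ i, ℓ i ∈ K)
    (F : Set (Fin d → ℝ)) (hF : F.Nonempty)
    (hFsub : F ⊆ α • {f : Fin d → ℝ | ∀ y ∈ K, |f ⬝ᵥ y| ≤ 1}) :
    ((2 : ℝ) ^ t)⁻¹ *
        ∑ σ : Fin t → Bool,
          sSup ((fun w : Fin d → ℝ =>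
            (1 / (t : ℝ)) * ∑ i : Fin t, (if σ i then (1 : ℝ) else -1) * (w ⬝ᵥ ℓ i)) '' F)
      ≤ α * Real.sqrt ((d : ℝ) / (t : ℝ)) := by
  obtain ⟨M, ⟨hs, hp, h1⟩, hM⟩ := john_exists K hKconv hKcomp hKsymm hKint
  have ht' : (0 : ℝ) < t := by exact_mod_cast ht
  have hst : 0 < Real.sqrt t := Real.sqrt_pos.2 ht'
  have hst2 : Real.sqrt t * Real.sqrt t = t := Real.mul_self_sqrt ht'.le
  set Q : (Fin t → Bool) → ℝ := fun σ =>
    (∑ i, rsgn (σ i) • ℓ i) ⬝ᵥ M *ᵥ (∑ i, rsgn (σ i) • ℓ i) with hQ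
  have hQ0 : ∀ σ, 0 ≤ Q σ := fun σ => hp _
  have hsup : ∀ σ : Fin t → Bool, sSup ((fun w : Fin d → ℝ =>
      (1 / (t : ℝ)) * ∑ i : Fin t, (if σ i then (1 : ℝ) else -1) * (w ⬝ᵥ ℓ i)) '' F)
      ≤ α / t * Real.sqrt d * ((Q σ / Real.sqrt t + Real.sqrt t) / 2) := by
    intro σ
    refine csSup_le (hF.image _) ?_
    rintro _ ⟨w, hw, rfl⟩
    obtain ⟨v, hv, rfl⟩ := hFsub hw
    have e : ∑ i : Fin t, (if σ i then (1 : ℝ) else -1) * ((α • v) ⬝ᵥ ℓ i)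
        = α * (v ⬝ᵥ ∑ i, rsgn (σ i) • ℓ i) := by
      rw [dotProduct_sum, Finset.mul_sum]
      refine Finset.sum_congr rfl fun i _ => ?_
      rw [smul_dotProduct, dotProduct_smul, smul_eq_mul, smul_eq_mul, rsgn]
      ring
    have h2 : v ⬝ᵥ ∑ i, rsgn (σ i) • ℓ i ≤ Real.sqrt d * Real.sqrt (Q σ) := by
      rw [← Real.sqrt_mul (Nat.cast_nonneg d)]
      exact Real.le_sqrt_of_sq_le (hM v hv _)
    have h3 : Real.sqrt (Q σ) ≤ (Q σ / Real.sqrt t + Real.sqrt t) / 2 := by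
      have e1 : Q σ / Real.sqrt t * Real.sqrt t = Q σ := by field_simp
      have e2 := Real.mul_self_sqrt (hQ0 σ)
      refine le_of_mul_le_mul_right ?_ hst
      nlinarith [sq_nonneg (Real.sqrt (Q σ) - Real.sqrt t)]
    simp only [e]
    calc 1 / (t : ℝ) * (α * (v ⬝ᵥ ∑ i, rsgn (σ i) • ℓ i))
        = α / t * (v ⬝ᵥ ∑ i, rsgn (σ i) • ℓ i) := by ring
      _ ≤ α / t * (Real.sqrt d * ((Q σ / Real.sqrt t + Real.sqrt t) / 2)) := by
          gcongr
          exact h2.trans (by gcongr)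
      _ = _ := by ring
  have hsumQ : ∑ σ, Q σ ≤ 2 ^ t * t := by
    rw [hQ, rad_quad]
    gcongr
    calc ∑ i, ℓ i ⬝ᵥ M *ᵥ ℓ i ≤ ∑ i : Fin t, (1 : ℝ) :=
          Finset.sum_le_sum fun i _ => h1 _ (hℓ i)
      _ = t := by simp
  have hsum : ∑ σ, ((Q σ / Real.sqrt t + Real.sqrt t) / 2) ≤ 2 ^ t * Real.sqrt t := by
    rw [← Finset.sum_div, Finset.sum_add_distrib, ← Finset.sum_div]
    have : (∑ σ, Q σ) / Real.sqrt t ≤ 2 ^ t * Real.sqrt t := by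
      rw [div_le_iff₀ hst, mul_assoc, hst2]
      exact hsumQ
    simp
    linarith
  calc _ ≤ ((2 : ℝ) ^ t)⁻¹ * ∑ σ : Fin t → Bool,
        α / t * Real.sqrt d * ((Q σ / Real.sqrt t + Real.sqrt t) / 2) := by
        gcongr with σ
        exact hsup σ
    _ ≤ ((2 : ℝ) ^ t)⁻¹ * (α / t * Real.sqrt d * (2 ^ t * Real.sqrt t)) := by
        rw [← Finset.mul_sum]
        gcongr
    _ = α * Real.sqrt ((d : ℝ) / (t : ℝ)) := by
        rw [Real.sqrt_div (Nat.cast_nonneg d)]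
        field_simp
        rw [pow_two, hst2, mul_comm]
end

section
/- Let K ⊆ ℝ^d be a compact convex set, symmetric about the origin (K = −K), with nonempty interior, and let K* = {f ∈ ℝ^d : |f·y| ≤ 1 for all y ∈ K}. Then there exists a symmetric positive semidefinite matrix Σ ∈ ℝ^{d×d} such that for every x ∈ ℝ^d: xᵀΣx ≤ (sup_{f ∈ K*} |f·x|)² ≤ d·(xᵀΣx). -/
open Matrix

/-- The quadratic form of the sum of two basis vectors. -/
lemma aux_quad {d : ℕ} (S : Matrix (Fin d) (Fin d) ℝ) (i j : Fin d) (c : ℝ) :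
    (Pi.single i 1 + c • Pi.single j 1 : Fin d → ℝ) ⬝ᵥ
      S.mulVec (Pi.single i 1 + c • Pi.single j 1)
      = S i i + c * S i j + c * S j i + c * c * S j j := by
  simp [Matrix.mulVec_add, Matrix.mulVec_smul, add_dotProduct, smul_dotProduct]
  ring

lemma aux_compact {d : ℕ} (N : (Fin d → ℝ) → ℝ) :
    IsCompact {S : Matrix (Fin d) (Fin d) ℝ | Sᵀ = S ∧
      ∀ x, 0 ≤ x ⬝ᵥ S.mulVec x ∧ x ⬝ᵥ S.mulVec x ≤ N x ^ 2} := by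
  have hcl : IsClosed {S : Matrix (Fin d) (Fin d) ℝ | Sᵀ = S ∧
      ∀ x, 0 ≤ x ⬝ᵥ S.mulVec x ∧ x ⬝ᵥ S.mulVec x ≤ N x ^ 2} := by
    have hq : ∀ x : Fin d → ℝ,
        Continuous (fun S : Matrix (Fin d) (Fin d) ℝ => x ⬝ᵥ S.mulVec x) := by
      intro x
      exact continuous_const.dotProduct (continuous_id.matrix_mulVec continuous_const)
    simp only [Set.ofPred_and, Set.ofPred_forall]
    refine IsClosed.inter (isClosed_eq continuous_id.matrix_transpose continuous_id) ?_
    exact isClosed_iInter fun x => IsClosed.inter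
      (isClosed_le continuous_const (hq x)) (isClosed_le (hq x) continuous_const)
  have hbox : IsCompact (Set.pi Set.univ (fun i : Fin d => Set.pi Set.univ (fun j : Fin d =>
      Set.Icc (-(N (Pi.single i 1) ^ 2 + N (Pi.single j 1) ^ 2))
        (N (Pi.single i 1) ^ 2 + N (Pi.single j 1) ^ 2)))) :=
    isCompact_univ_pi fun i => isCompact_univ_pi fun j => isCompact_Icc
  refine IsCompact.of_isClosed_subset hbox hcl ?_
  rintro S ⟨hS, h⟩
  intro i _ j _
  have h1 := (h (Pi.single i 1 + (1:ℝ) • Pi.single j 1)).1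
  have h2 := (h (Pi.single i 1 + (-1:ℝ) • Pi.single j 1)).1
  have h3 := (h (Pi.single i 1 + (0:ℝ) • Pi.single i 1)).2
  have h4 := (h (Pi.single j 1 + (0:ℝ) • Pi.single j 1)).2
  have h5 := (h (Pi.single i 1 + (0:ℝ) • Pi.single i 1)).1
  have h6 := (h (Pi.single j 1 + (0:ℝ) • Pi.single j 1)).1
  rw [aux_quad] at h1 h2 h3 h4 h5 h6
  have hs : S j i = S i j := by
    conv_lhs => rw [← hS]
    rfl
  simp only [zero_smul, add_zero] at h3 h4
  constructor <;> nlinarith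

lemma aux_real {d : ℕ} {a : ℝ} (h : ∀ u : ℝ, 0 < u → 1 + u * a ≤ (1 + u) ^ d) : a ≤ d := by
  refine le_of_forall_pos_le_add fun e he => ?_
  set D : ℝ := (d : ℝ) with hD
  have hD0 : 0 ≤ D := Nat.cast_nonneg d
  set u : ℝ := min (1 / (D + 1)) (e / (D ^ 2 + 1)) with hu
  have hu0 : 0 < u := by positivity
  have hu1 : u * (D + 1) ≤ 1 := (le_div_iff₀ (by positivity)).1 (min_le_left _ _)
  have hu2 : u * (D ^ 2 + 1) ≤ e := (le_div_iff₀ (by positivity)).1 (min_le_right _ _)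
  have h1 := h u hu0
  have h2 : (1 + u) ^ d ≤ Real.exp (D * u) := by
    rw [hD, Real.exp_nat_mul]
    gcongr
    linarith [Real.add_one_le_exp u]
  have h3 := Real.abs_exp_sub_one_sub_id_le (x := D * u) (by
    rw [abs_of_nonneg (by positivity)]; nlinarith)
  have h4 := (abs_le.1 h3).2
  have h5 : u * a ≤ u * (D + e) := by nlinarith
  exact le_of_mul_le_mul_left h5 hu0

/-- Optimal design argument: the maximiser of the determinant. -/
lemma aux_main {d : ℕ} (L : Set (Fin d → ℝ)) (N : (Fin d → ℝ) → ℝ)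
    (hN : ∀ f ∈ L, ∀ x, |f ⬝ᵥ x| ≤ N x) (e : ℝ) (he : 0 < e)
    (hlow : ∀ x, e * (x ⬝ᵥ x) ≤ N x ^ 2) :
    ∃ S : Matrix (Fin d) (Fin d) ℝ, Sᵀ = S ∧
      (∀ x, 0 ≤ x ⬝ᵥ S.mulVec x ∧ x ⬝ᵥ S.mulVec x ≤ N x ^ 2) ∧
      ∀ f ∈ L, ∀ x, (f ⬝ᵥ x) ^ 2 ≤ d * (x ⬝ᵥ S.mulVec x) := by
  have hmem : e • (1 : Matrix (Fin d) (Fin d) ℝ) ∈ {S : Matrix (Fin d) (Fin d) ℝ | Sᵀ = S ∧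
      ∀ x, 0 ≤ x ⬝ᵥ S.mulVec x ∧ x ⬝ᵥ S.mulVec x ≤ N x ^ 2} := by
    refine ⟨by simp, fun x => ?_⟩
    have : x ⬝ᵥ (e • (1 : Matrix (Fin d) (Fin d) ℝ)).mulVec x = e * (x ⬝ᵥ x) := by
      simp [Matrix.smul_mulVec]
    rw [this]
    refine ⟨mul_nonneg he.le ?_, hlow x⟩
    exact Finset.sum_nonneg fun i _ => mul_self_nonneg _
  obtain ⟨S, ⟨hSs, hSq⟩, hmax⟩ := (aux_compact N).exists_isMaxOn ⟨_, hmem⟩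
    (f := fun S => S.det) (continuous_id.matrix_det.continuousOn)
  have hdet : 0 < S.det := by
    refine lt_of_lt_of_le ?_ (hmax hmem)
    simp only [Matrix.det_smul, Matrix.det_one]
    positivity
  refine ⟨S, hSs, hSq, fun f hf x => ?_⟩
  have hunit : IsUnit S.det := hdet.ne'.isUnit
  set w := S⁻¹.mulVec f with hw
  have hSw : S.mulVec w = f := by
    rw [hw, Matrix.mulVec_mulVec, Matrix.mul_nonsing_inv _ hunit, Matrix.one_mulVec]
  have hwS : ∀ y, w ⬝ᵥ S.mulVec y = f ⬝ᵥ y := by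
    intro y
    rw [Matrix.dotProduct_mulVec, ← Matrix.mulVec_transpose, hSs, hSw]
  have ha : f ⬝ᵥ w ≤ d := by
    apply aux_real
    intro u hu
    have hT : (1 + u)⁻¹ • (S + u • vecMulVec f f) ∈ {S : Matrix (Fin d) (Fin d) ℝ | Sᵀ = S ∧
        ∀ x, 0 ≤ x ⬝ᵥ S.mulVec x ∧ x ⬝ᵥ S.mulVec x ≤ N x ^ 2} := by
      refine ⟨by simp [hSs, Matrix.transpose_vecMulVec], fun y => ?_⟩
      have hy : y ⬝ᵥ ((1 + u)⁻¹ • (S + u • vecMulVec f f)).mulVec y =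
          (1 + u)⁻¹ * (y ⬝ᵥ S.mulVec y + u * (f ⬝ᵥ y) ^ 2) := by
        simp only [Matrix.smul_mulVec, Matrix.add_mulVec, Matrix.vecMulVec_mulVec,
          dotProduct_smul, dotProduct_add, smul_eq_mul, op_smul_eq_smul]
        rw [dotProduct_comm y f]
        ring
      rw [hy]
      obtain ⟨h1, h2⟩ := hSq y
      refine ⟨by positivity, ?_⟩
      have h3 : (f ⬝ᵥ y) ^ 2 ≤ N y ^ 2 := by
        rw [← sq_abs (f ⬝ᵥ y)]
        exact pow_le_pow_left₀ (abs_nonneg _) (hN f hf y) 2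
      rw [inv_mul_le_iff₀ (by positivity)]
      nlinarith
    have h1 : ((1 + u)⁻¹ • (S + u • vecMulVec f f)).det ≤ S.det := hmax hT
    have h2 : (S + u • vecMulVec f f).det = S.det * (1 + u * (f ⬝ᵥ w)) := by
      have : S + u • vecMulVec f f
          = S * (1 + replicateCol Unit (u • w) * replicateRow Unit f) := by
        rw [Matrix.mul_add, Matrix.mul_one, ← Matrix.vecMulVec_eq, Matrix.mul_vecMulVec,
          Matrix.mulVec_smul, hSw, Matrix.smul_vecMulVec]
      rw [this, Matrix.det_mul, Matrix.det_one_add_replicateCol_mul_replicateRow,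
        dotProduct_smul, smul_eq_mul]
    rw [Matrix.det_smul, Fintype.card_fin, h2, inv_pow, inv_mul_le_iff₀ (by positivity),
      mul_comm _ S.det] at h1
    exact le_of_mul_le_mul_left h1 hdet
  rcases Nat.eq_zero_or_pos d with h0 | hd
  · subst h0
    simp
  have hD : (0:ℝ) < d := by exact_mod_cast hd
  set p := f ⬝ᵥ x with hp
  have h := (hSq ((d:ℝ) • x - p • w)).1
  have hexp : ((d:ℝ) • x - p • w) ⬝ᵥ S.mulVec ((d:ℝ) • x - p • w)
      = d ^ 2 * (x ⬝ᵥ S.mulVec x) - 2 * d * p ^ 2 + p ^ 2 * (f ⬝ᵥ w) := by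
    simp only [Matrix.mulVec_sub, Matrix.mulVec_smul, sub_dotProduct, dotProduct_sub,
      smul_dotProduct, dotProduct_smul, smul_eq_mul, hwS, hSw, ← hp]
    rw [dotProduct_comm x f, dotProduct_comm w f, ← hp]
    ring
  rw [hexp] at h
  have h2 : p ^ 2 * (f ⬝ᵥ w) ≤ p ^ 2 * d := mul_le_mul_of_nonneg_left ha (sq_nonneg p)
  refine le_of_mul_le_mul_left (a := (d:ℝ)) ?_ hD
  nlinarith

/-- Corollary of John's theorem. For a compact, symmetric (`K = -K`)
convex body `K ⊆ ℝ^d` with nonempty interior, with dual set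
`K* = {f : |f·y| ≤ 1 ∀ y ∈ K}`, there is a symmetric positive semidefinite matrix `S`
such that `xᵀSx ≤ (sup_{f ∈ K*} |f·x|)² ≤ d·(xᵀSx)` for all `x`. -/
theorem stmt7 (d : ℕ) (K : Set (Fin d → ℝ)) (hKconv : Convex ℝ K)
    (hKcomp : IsCompact K) (hKsymm : K = -K) (hKint : (interior K).Nonempty) :
    ∃ S : Matrix (Fin d) (Fin d) ℝ, S.IsSymm ∧ S.PosSemidef ∧
      ∀ x : Fin d → ℝ,
        x ⬝ᵥ S.mulVec x ≤ (sSup ((fun f => |f ⬝ᵥ x|) '' {f | ∀ y ∈ K, |f ⬝ᵥ y| ≤ 1})) ^ 2 ∧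
        (sSup ((fun f => |f ⬝ᵥ x|) '' {f | ∀ y ∈ K, |f ⬝ᵥ y| ≤ 1})) ^ 2 ≤
          (d : ℝ) * (x ⬝ᵥ S.mulVec x) := by
  set L : Set (Fin d → ℝ) := {f | ∀ y ∈ K, |f ⬝ᵥ y| ≤ 1} with hL
  -- the dual set is bounded
  obtain ⟨y0, hy0⟩ := hKint
  obtain ⟨r, hr, hball⟩ := Metric.isOpen_iff.1 isOpen_interior y0 hy0
  have hcoord : ∀ f ∈ L, ∀ i, |f i| ≤ 2 / (r / 2) := by
    intro f hf i
    have h1 := hf y0 (interior_subset hy0)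
    have h2 := hf (y0 + Pi.single i (r / 2)) (interior_subset (hball (by
      rw [mem_ball_iff_norm, add_sub_cancel_left, Pi.norm_single, Real.norm_eq_abs,
        abs_of_pos (by positivity)]
      linarith)))
    rw [dotProduct_add, dotProduct_single] at h2
    rw [le_div_iff₀ (by positivity)]
    have h3 : |f i| * (r / 2) = |f i * (r / 2)| := by
      rw [abs_mul, abs_of_pos (by positivity : 0 < r / 2)]
    rw [h3]
    rw [abs_le] at *
    constructor <;> linarith
  have hbdd : ∀ x, BddAbove ((fun f => |f ⬝ᵥ x|) '' L) := by
    intro x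
    refine ⟨∑ i, 2 / (r / 2) * |x i|, ?_⟩
    rintro _ ⟨f, hf, rfl⟩
    refine (Finset.abs_sum_le_sum_abs _ _).trans (Finset.sum_le_sum fun i _ => ?_)
    rw [abs_mul]
    exact mul_le_mul_of_nonneg_right (hcoord f hf i) (abs_nonneg _)
  have hN : ∀ f ∈ L, ∀ x, |f ⬝ᵥ x| ≤ sSup ((fun f => |f ⬝ᵥ x|) '' L) :=
    fun f hf x => le_csSup (hbdd x) ⟨f, hf, rfl⟩
  -- the dual set contains multiples of the basis vectors
  obtain ⟨R, hR, hKR⟩ := hKcomp.isBounded.exists_pos_norm_le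
  have hcont : ∀ i, Pi.single i R⁻¹ ∈ L := by
    intro i y hy
    rw [single_dotProduct, abs_mul, abs_of_pos (by positivity), inv_mul_le_iff₀ hR, mul_one]
    exact (norm_le_pi_norm y i).trans (hKR y hy)
  have hlow : ∀ x, (R ^ 2 * d + 1)⁻¹ * (x ⬝ᵥ x) ≤ sSup ((fun f => |f ⬝ᵥ x|) '' L) ^ 2 := by
    intro x
    set M := sSup ((fun f => |f ⬝ᵥ x|) '' L) with hM
    rw [inv_mul_le_iff₀ (by positivity)]
    have h1 : ∀ i, x i * x i ≤ R ^ 2 * M ^ 2 := by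
      intro i
      have h := hN _ (hcont i) x
      rw [single_dotProduct, abs_mul, abs_of_pos (by positivity), inv_mul_le_iff₀ hR] at h
      have h2 := pow_le_pow_left₀ (abs_nonneg _) h 2
      rw [sq_abs] at h2
      nlinarith
    have h2 : x ⬝ᵥ x ≤ ∑ _i : Fin d, R ^ 2 * M ^ 2 := Finset.sum_le_sum fun i _ => h1 i
    simp only [Finset.sum_const, Finset.card_univ, Fintype.card_fin, nsmul_eq_mul] at h2
    nlinarith [sq_nonneg M]
  obtain ⟨S, hSs, hSq, hup⟩ := aux_main L _ hN _ (by positivity) hlow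
  refine ⟨S, hSs, ?_, fun x => ⟨(hSq x).2, ?_⟩⟩
  · refine Matrix.PosSemidef.of_dotProduct_mulVec_nonneg ?_ fun x => ?_
    · rw [Matrix.IsHermitian, Matrix.conjTranspose_eq_transpose_of_trivial, hSs]
    · rw [star_trivial]
      exact (hSq x).1
  · have hq : 0 ≤ (d:ℝ) * (x ⬝ᵥ S.mulVec x) := mul_nonneg (Nat.cast_nonneg d) (hSq x).1
    have h0 : 0 ≤ sSup ((fun f => |f ⬝ᵥ x|) '' L) := by
      apply Real.sSup_nonneg
      rintro _ ⟨f, _, rfl⟩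
      exact abs_nonneg _
    have h1 : sSup ((fun f => |f ⬝ᵥ x|) '' L) ≤ Real.sqrt ((d:ℝ) * (x ⬝ᵥ S.mulVec x)) := by
      apply Real.sSup_le _ (Real.sqrt_nonneg _)
      rintro _ ⟨f, hf, rfl⟩
      exact Real.abs_le_sqrt (hup f hf x)
    calc _ ≤ Real.sqrt ((d:ℝ) * (x ⬝ᵥ S.mulVec x)) ^ 2 := pow_le_pow_left₀ h0 h1 2
      _ = _ := Real.sq_sqrt hq
end

section
/- Let M ∈ ℝ^{d×d} be symmetric positive definite, let U ∈ ℝ^{d×N} be an arbitrary matrix, let v ∈ ℝ^d, and set ℓ = Uᵀv ∈ ℝ^N and H = I_N + UᵀMU. Then H is positive definite (hence invertible) and ℓᵀH⁻¹ℓ ≤ vᵀM⁻¹v. -/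
open Matrix

/-- Let `M ∈ ℝ^{d×d}` be symmetric positive definite, `U ∈ ℝ^{d×N}`
arbitrary, `v ∈ ℝ^d`, `ℓ = Uᵀv`, `H = I_N + UᵀMU`. Then `H` is positive definite
(hence invertible) and `ℓᵀH⁻¹ℓ ≤ vᵀM⁻¹v`. -/
theorem stmt8 (d N : ℕ) (M : Matrix (Fin d) (Fin d) ℝ) (hMsym : M.IsSymm)
    (hMpd : M.PosDef) (U : Matrix (Fin d) (Fin N) ℝ) (v : Fin d → ℝ) :
    (1 + Uᵀ * M * U).PosDef ∧
      (Uᵀ.mulVec v) ⬝ᵥ (1 + Uᵀ * M * U)⁻¹.mulVec (Uᵀ.mulVec v) ≤ v ⬝ᵥ M⁻¹.mulVec v := by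
  have hH : (1 + Uᵀ * M * U).PosDef := by
    have h := hMpd.posSemidef.conjTranspose_mul_mul_same U
    rw [conjTranspose_eq_transpose_of_trivial] at h
    exact PosDef.one.add_posSemidef h
  refine ⟨hH, ?_⟩
  have hHdet := (Matrix.isUnit_iff_isUnit_det _).1 hH.isUnit
  have hMdet := (Matrix.isUnit_iff_isUnit_det _).1 hMpd.isUnit
  obtain ⟨x, hx⟩ : ∃ x, x = (1 + Uᵀ * M * U)⁻¹ *ᵥ (Uᵀ *ᵥ v) := ⟨_, rfl⟩
  obtain ⟨w, hw⟩ : ∃ w, w = M⁻¹ *ᵥ v := ⟨_, rfl⟩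
  have hHx : x + Uᵀ *ᵥ (M *ᵥ (U *ᵥ x)) = Uᵀ *ᵥ v := by
    have h : (1 + Uᵀ * M * U) *ᵥ x = Uᵀ *ᵥ v := by
      rw [hx, mulVec_mulVec, Matrix.mul_nonsing_inv _ hHdet, one_mulVec]
    rw [← h, add_mulVec, one_mulVec, mulVec_mulVec, mulVec_mulVec, Matrix.mul_assoc]
  have hMw : M *ᵥ w = v := by
    rw [hw, mulVec_mulVec, Matrix.mul_nonsing_inv _ hMdet, one_mulVec]
  rw [← hx, ← hw]
  have hU : ∀ z : Fin d → ℝ, (Uᵀ *ᵥ z) ⬝ᵥ x = z ⬝ᵥ (U *ᵥ x) := fun z => by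
    rw [mulVec_transpose, dotProduct_mulVec]
  have h1 := congrArg (· ⬝ᵥ x) hHx
  simp only [add_dotProduct, hU] at h1
  rw [hU]
  generalize U *ᵥ x = y at h1 ⊢
  have h2 := hMpd.posSemidef.dotProduct_mulVec_nonneg (w - y)
  have h3 : w ⬝ᵥ (M *ᵥ y) = v ⬝ᵥ y := by
    rw [dotProduct_mulVec, ← mulVec_transpose, hMsym.eq, hMw]
  have h4 : 0 ≤ x ⬝ᵥ x := Finset.sum_nonneg fun i _ => mul_self_nonneg (x i)
  rw [star_trivial, mulVec_sub, hMw, sub_dotProduct, dotProduct_sub, dotProduct_sub, h3,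
    dotProduct_comm w v, dotProduct_comm y v, dotProduct_comm y] at h2
  linarith
end

section
/- Let u₁,…,u_N ∈ ℝ^d and v₁,…,v_t ∈ ℝ^d satisfy |u_j·v_i| ≤ 2 for all i ∈ [t], j ∈ [N]. Then 2^{−t} Σ_{σ ∈ {−1,1}^t} max_{j∈[N]} (1/t) Σ_{i=1}^t σ_i (u_j·v_i) ≤ 2√(d/t). -/
open Matrix

lemma rad_second_moment : ∀ (t : ℕ) (a : Fin t → ℝ),
    ∑ σ : Fin t → Bool, (∑ i : Fin t, (if σ i then (1 : ℝ) else -1) * a i) ^ 2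
      = 2 ^ t * ∑ i, a i ^ 2 := by
  intro t
  induction t with
  | zero => intro a; simp
  | succ n ih =>
    intro a
    rw [← (Fin.consEquiv (fun _ : Fin (n + 1) => Bool)).sum_comp, Fintype.sum_prod_type]
    simp only [Fin.consEquiv, Equiv.coe_fn_mk, Fin.sum_univ_succ, Fin.cons_zero, Fin.cons_succ,
      Fintype.sum_bool, if_true, Bool.false_eq_true, if_false]
    rw [← Finset.sum_add_distrib]
    have e : ∀ x : ℝ, (1 * a 0 + x) ^ 2 + (-1 * a 0 + x) ^ 2 = 2 * a 0 ^ 2 + 2 * x ^ 2 := by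
      intro x; ring
    simp only [e]
    rw [Finset.sum_add_distrib, ← Finset.mul_sum, ← Finset.mul_sum, ih (fun i => a i.succ)]
    simp
    ring

lemma rad_dual (d t : ℕ) (v : Fin t → Fin d → ℝ) :
    ∃ (k : ℕ) (e : Fin k → Fin t → ℝ), k ≤ d ∧ (∀ m, ∑ i, e m i ^ 2 = 1) ∧
      ∀ (x : Fin d → ℝ) (s : Fin t → ℝ),
        ∑ i, s i * (x ⬝ᵥ v i) ≤
          Real.sqrt (∑ m, (∑ i, s i * e m i) ^ 2) * Real.sqrt (∑ i, (x ⬝ᵥ v i) ^ 2) := by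
  let L : (Fin d → ℝ) →ₗ[ℝ] EuclideanSpace ℝ (Fin t) :=
    (WithLp.linearEquiv 2 ℝ (Fin t → ℝ)).symm.toLinearMap ∘ₗ (Matrix.mulVecLin (Matrix.of v))
  have hL : ∀ x i, L x i = x ⬝ᵥ v i := by
    intro x i
    simp [L, Matrix.mulVec, dotProduct_comm]
  let W := LinearMap.range L
  let b := stdOrthonormalBasis ℝ W
  refine ⟨Module.finrank ℝ W, fun m i => (b m : EuclideanSpace ℝ (Fin t)) i, ?_, ?_, ?_⟩
  · simpa using LinearMap.finrank_range_le L
  · intro m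
    have h1 : ‖(b m : EuclideanSpace ℝ (Fin t))‖ = 1 := by
      have := b.orthonormal.1 m
      exact this
    have h2 := EuclideanSpace.real_norm_sq_eq (b m : EuclideanSpace ℝ (Fin t))
    rw [← h2, h1]; norm_num
  · intro x s
    let w : W := ⟨L x, x, rfl⟩
    have hw : ∀ i, x ⬝ᵥ v i = ∑ m, inner ℝ (b m) w * (b m : EuclideanSpace ℝ (Fin t)) i := by
      intro i
      rw [← hL]
      have h1 := congrArg (fun z : W => (z : EuclideanSpace ℝ (Fin t)) i) (b.sum_repr' w)
      simp at h1
      rw [← show (w : EuclideanSpace ℝ (Fin t)) i = L x i from rfl, ← h1]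
      simp
    have hn : ∑ i, (x ⬝ᵥ v i) ^ 2 = ∑ m, (inner ℝ (b m) w) ^ 2 := by
      have h1 := b.sum_sq_norm_inner_right w
      have h2 := EuclideanSpace.real_norm_sq_eq (L x)
      simp only [hL] at h2
      simp only [Real.norm_eq_abs, sq_abs] at h1
      rw [← h2, h1]; rfl
    rw [hn]
    have : ∑ i, s i * (x ⬝ᵥ v i) =
        ∑ m, (∑ i, s i * (b m : EuclideanSpace ℝ (Fin t)) i) * inner ℝ (b m) w := by
      simp only [hw, Finset.mul_sum, Finset.sum_mul]
      rw [Finset.sum_comm]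
      refine Finset.sum_congr rfl fun m _ => Finset.sum_congr rfl fun i _ => by ring
    rw [this]
    exact Real.sum_mul_le_sqrt_mul_sqrt _ _ _

/-- empirical Rademacher complexity of a finite class of linear
functionals. If `|u_j·v_i| ≤ 2` for all `i ∈ [t]`, `j ∈ [N]`, then
`2^{−t} Σ_{σ∈{−1,1}^t} max_j (1/t) Σ_i σ_i (u_j·v_i) ≤ 2√(d/t)`. -/
theorem stmt11 (d N t : ℕ) (hN : 0 < N) (ht : 0 < t)
    (u : Fin N → Fin d → ℝ) (v : Fin t → Fin d → ℝ)
    (h : ∀ (i : Fin t) (j : Fin N), |u j ⬝ᵥ v i| ≤ 2) :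
    ((2 : ℝ) ^ t)⁻¹ *
        ∑ σ : Fin t → Bool,
          Finset.univ.sup' (Finset.univ_nonempty_iff.mpr (Fin.pos_iff_nonempty.mp hN))
            (fun j : Fin N =>
              (1 / (t : ℝ)) * ∑ i : Fin t, (if σ i then (1 : ℝ) else -1) * (u j ⬝ᵥ v i))
      ≤ 2 * Real.sqrt ((d : ℝ) / (t : ℝ)) := by
  obtain ⟨k, e, hk, he, hd⟩ := rad_dual d t v
  have ht' : (0 : ℝ) < t := by exact_mod_cast ht
  let Q : (Fin t → Bool) → ℝ := fun σ =>
    ∑ m, (∑ i, (if σ i then (1 : ℝ) else -1) * e m i) ^ 2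
  have hQ0 : ∀ σ, 0 ≤ Q σ := fun σ => Finset.sum_nonneg fun m _ => sq_nonneg _
  have hQ : ∑ σ, Q σ = 2 ^ t * k := by
    simp only [Q]
    rw [Finset.sum_comm]
    simp only [rad_second_moment, he]
    simp [mul_comm]
  have hS : ∑ σ, Real.sqrt (Q σ) ≤ 2 ^ t * Real.sqrt d := by
    have h1 := sq_sum_le_card_mul_sum_sq (s := (Finset.univ : Finset (Fin t → Bool)))
      (f := fun σ => Real.sqrt (Q σ))
    simp only [Real.sq_sqrt (hQ0 _), hQ] at h1
    simp only [Finset.card_univ, Fintype.card_fun, Fintype.card_bool, Fintype.card_fin] at h1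
    push_cast at h1
    refine (sq_le_sq₀ (Finset.sum_nonneg fun _ _ => Real.sqrt_nonneg _) (by positivity)).mp ?_
    rw [mul_pow, Real.sq_sqrt (by positivity)]
    have hk' : (k : ℝ) ≤ d := by exact_mod_cast hk
    refine h1.trans ?_
    rw [← mul_assoc, ← sq]
    gcongr
  have hn : ∀ j, Real.sqrt (∑ i, (u j ⬝ᵥ v i) ^ 2) ≤ 2 * Real.sqrt t := by
    intro j
    refine Real.sqrt_le_iff.mpr ⟨by positivity, ?_⟩
    rw [mul_pow, Real.sq_sqrt ht'.le]
    calc ∑ i, (u j ⬝ᵥ v i) ^ 2 ≤ ∑ i : Fin t, (2 : ℝ) ^ 2 := by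
          refine Finset.sum_le_sum fun i _ => ?_
          exact sq_le_sq' (abs_le.mp (h i j)).1 (abs_le.mp (h i j)).2
      _ = _ := by simp [mul_comm]
  have hmain : ∀ σ : Fin t → Bool,
      Finset.univ.sup' (Finset.univ_nonempty_iff.mpr (Fin.pos_iff_nonempty.mp hN))
            (fun j : Fin N =>
              (1 / (t : ℝ)) * ∑ i : Fin t, (if σ i then (1 : ℝ) else -1) * (u j ⬝ᵥ v i))
        ≤ (1 / (t : ℝ)) * (2 * Real.sqrt t) * Real.sqrt (Q σ) := by
    intro σ
    refine Finset.sup'_le _ _ fun j _ => ?_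
    rw [mul_assoc]
    refine mul_le_mul_of_nonneg_left ?_ (by positivity)
    refine (hd (u j) _).trans ?_
    rw [mul_comm]
    exact mul_le_mul_of_nonneg_right (hn j) (Real.sqrt_nonneg _)
  calc _ ≤ ((2 : ℝ) ^ t)⁻¹ * ∑ σ, (1 / (t : ℝ)) * (2 * Real.sqrt t) * Real.sqrt (Q σ) := by
        refine mul_le_mul_of_nonneg_left (Finset.sum_le_sum fun σ _ => hmain σ) (by positivity)
    _ ≤ ((2 : ℝ) ^ t)⁻¹ * ((1 / (t : ℝ)) * (2 * Real.sqrt t) * (2 ^ t * Real.sqrt d)) := by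
        rw [← Finset.mul_sum]
        gcongr
    _ = _ := by
        rw [Real.sqrt_div (by positivity)]
        have hs : Real.sqrt t ≠ 0 := (Real.sqrt_pos.mpr ht').ne'
        have hs2 : (t : ℝ) = Real.sqrt t * Real.sqrt t := (Real.mul_self_sqrt ht'.le).symm
        have : 1 / (t : ℝ) * Real.sqrt t = 1 / Real.sqrt t := by
          rw [div_mul_eq_mul_div, div_eq_div_iff ht'.ne' hs]
          linarith
        calc _ = ((2 : ℝ) ^ t)⁻¹ * 2 ^ t * (2 * (1 / (t : ℝ) * Real.sqrt t) * Real.sqrt d) := by ring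
          _ = _ := by
            rw [this, inv_mul_cancel₀ (by positivity)]
            ring
end

section
/- (AdaGrad lower bound.) There exists N₀ such that for every even N ≥ N₀, every η > 0, every δ > 0, and every positive integer T with T < √N/6, there exists a sequence of loss vectors ℓ₁,…,ℓ_T ∈ [−1,1]^N whose loss matrix has rank 1, such that the AdaGrad iterates x₁,…,x_T defined by x₁ = (1/N)𝟙, S₀ = δI_N, S_t = S_{t−1} + ℓ_tℓ_tᵀ, G_t = S_t^{1/2} (the unique symmetric positive definite square root), y_{t+1} = x_t − ηG_t⁻¹ℓ_t, and x_{t+1} = argmin_{x ∈ Δ_N} (y_{t+1}−x)ᵀG_t(y_{t+1}−x), satisfy Σ_{t=1}^T x_t·ℓ_t − min_{i∈[N]} Σ_{t=1}^T ℓ_t(i) ≥ T/2. -/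
open Matrix

/-- `G² v = g² v`, `G` positive definite and `g > 0` force `G v = g v`. -/
lemma eig_of_sq {N : ℕ} (G : Matrix (Fin N) (Fin N) ℝ) (hG : G.PosDef) (v : Fin N → ℝ) (g : ℝ)
    (hg : 0 < g) (h : (G * G) *ᵥ v = (g ^ 2) • v) : G *ᵥ v = g • v := by
  by_contra hne
  set u := G *ᵥ v - g • v with hu
  have hu0 : u ≠ 0 := sub_ne_zero.mpr hne
  have hpos := hG.dotProduct_mulVec_pos hu0
  have hGu : G *ᵥ u = -(g • u) := by
    rw [hu, mulVec_sub, mulVec_mulVec, h, mulVec_smul, smul_sub, smul_smul]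
    ext i
    simp only [Pi.sub_apply, Pi.smul_apply, Pi.neg_apply, smul_eq_mul]
    ring
  rw [hGu] at hpos
  simp only [star_trivial, dotProduct_neg, dotProduct_smul, smul_eq_mul] at hpos
  have : 0 ≤ u ⬝ᵥ u := Finset.sum_nonneg fun i _ => mul_self_nonneg _
  nlinarith

lemma inv_eig {N : ℕ} (G : Matrix (Fin N) (Fin N) ℝ) (hG : G.PosDef) (v : Fin N → ℝ) (g : ℝ)
    (hg : 0 < g) (h : G *ᵥ v = g • v) : G⁻¹ *ᵥ v = g⁻¹ • v := by
  have hu : IsUnit G.det := hG.det_pos.ne'.isUnit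
  have h1 : v = g⁻¹ • (G *ᵥ v) := by rw [h, smul_smul, inv_mul_cancel₀ hg.ne', one_smul]
  have h2 : G⁻¹ *ᵥ (G *ᵥ v) = v := by rw [mulVec_mulVec, nonsing_inv_mul _ hu, one_mulVec]
  conv_lhs => rw [h1, mulVec_smul, h2]

/-- Quadratic form of `a v + w` with `w ⟂ v`, `G v = g v`. -/
lemma quad_form {N : ℕ} (G : Matrix (Fin N) (Fin N) ℝ) (hs : G.IsSymm) (v w : Fin N → ℝ) (g a : ℝ)
    (h : G *ᵥ v = g • v) (hw : w ⬝ᵥ v = 0) :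
    (a • v + w) ⬝ᵥ G *ᵥ (a • v + w) = a ^ 2 * g * (v ⬝ᵥ v) + w ⬝ᵥ G *ᵥ w := by
  have h1 : v ⬝ᵥ G *ᵥ w = 0 := by
    rw [dotProduct_mulVec, ← mulVec_transpose, hs.eq, h, smul_dotProduct, dotProduct_comm, hw]; simp
  rw [mulVec_add, mulVec_smul, h]
  simp only [add_dotProduct, dotProduct_add, smul_dotProduct, dotProduct_smul, h1, hw, smul_eq_mul]
  ring

lemma S_eig {N : ℕ} (T : ℕ) (δ M : ℝ) (S : ℕ → Matrix (Fin N) (Fin N) ℝ) (v : Fin N → ℝ)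
    (c : ℕ → ℝ) (hc : ∀ t, c t ^ 2 = 1) (hM : v ⬝ᵥ v = M)
    (h0 : S 0 = δ • (1 : Matrix (Fin N) (Fin N) ℝ))
    (h1 : ∀ t < T, S (t + 1) = S t + vecMulVec (c t • v) (c t • v)) :
    ∀ t ≤ T, S t *ᵥ v = (δ + t * M) • v := by
  intro t
  induction t with
  | zero => intro _; rw [h0, smul_mulVec, one_mulVec]; simp
  | succ t ih =>
    intro ht
    rw [h1 t (by omega), add_mulVec, ih (by omega), vecMulVec_mulVec, smul_dotProduct, hM]
    ext i
    simp only [Pi.add_apply, Pi.smul_apply, smul_eq_mul, MulOpposite.smul_eq_mul_unop,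
      MulOpposite.unop_op]
    push_cast
    linear_combination M * v i * hc t

lemma G_eig {N : ℕ} (T : ℕ) (δ M : ℝ) (hδ : 0 < δ) (hM0 : 0 ≤ M)
    (S G : ℕ → Matrix (Fin N) (Fin N) ℝ) (v : Fin N → ℝ)
    (c : ℕ → ℝ) (hc : ∀ t, c t ^ 2 = 1) (hM : v ⬝ᵥ v = M)
    (h0 : S 0 = δ • (1 : Matrix (Fin N) (Fin N) ℝ))
    (h1 : ∀ t < T, S (t + 1) = S t + vecMulVec (c t • v) (c t • v))
    (h2 : ∀ t < T, (G (t + 1)).IsSymm ∧ (G (t + 1)).PosDef ∧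
            G (t + 1) * G (t + 1) = S (t + 1)) :
    ∀ t < T, G (t + 1) *ᵥ v = Real.sqrt (δ + (t + 1) * M) • v := by
  intro t ht
  have hp : 0 < δ + ((t : ℝ) + 1) * M := by positivity
  refine eig_of_sq _ (h2 t ht).2.1 _ _ (Real.sqrt_pos.mpr hp) ?_
  rw [(h2 t ht).2.2, S_eig T δ M S v c hc hM h0 h1 (t + 1) (by omega), Real.sq_sqrt hp.le]
  push_cast
  rfl

lemma posdef_nonneg {N : ℕ} (G : Matrix (Fin N) (Fin N) ℝ) (hG : G.PosDef) (w : Fin N → ℝ) :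
    0 ≤ w ⬝ᵥ G *ᵥ w := by
  simpa using hG.posSemidef.dotProduct_mulVec_nonneg w

/-- One step in the slow regime. -/
lemma slow_step {N : ℕ} (G : Matrix (Fin N) (Fin N) ℝ) (hs : G.IsSymm) (hG : G.PosDef)
    (v : Fin N → ℝ) (g η : ℝ) (hg : 0 < g) (hη : 0 < η) (hv : v ⬝ᵥ v = 1)
    (h : G *ᵥ v = g • v) (x y x' : Fin N → ℝ) (hx : x ∈ stdSimplex ℝ (Fin N))
    (hy : y = x - η • G⁻¹ *ᵥ ((-1 : ℝ) • v))
    (hx' : x' ∈ stdSimplex ℝ (Fin N))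
    (hmin : ∀ z ∈ stdSimplex ℝ (Fin N), (y - x') ⬝ᵥ G *ᵥ (y - x') ≤ (y - z) ⬝ᵥ G *ᵥ (y - z)) :
    v ⬝ᵥ x' ≤ v ⬝ᵥ x + η / g := by
  by_contra hlt
  push Not at hlt
  rw [mulVec_smul, inv_eig G hG v g hg h] at hy
  set b := η / g with hb
  have hbp : 0 < b := by positivity
  have hy' : y = x + b • v := by
    rw [hy]; ext i; simp [hb]; field_simp
  set k := v ⬝ᵥ x' - v ⬝ᵥ x - b with hk
  have hkp : 0 < k := by linarith
  set r := y - x' + k • v with hr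
  have hrv : r ⬝ᵥ v = 0 := by
    rw [hr, hy', add_dotProduct, sub_dotProduct, add_dotProduct, smul_dotProduct, smul_dotProduct,
      hv, dotProduct_comm x v, dotProduct_comm x' v]
    simp; linarith
  have e1 : y - x' = (-k) • v + r := by rw [hr]; ext i; simp
  set θ := k / (k + b) with hθ
  have hθ0 : 0 < θ := by positivity
  have hθ1 : θ ≤ 1 := by rw [hθ, div_le_one (by positivity)]; linarith
  have hθk : θ * (k + b) = k := by rw [hθ]; field_simp
  have hz : (1 - θ) • x' + θ • x ∈ stdSimplex ℝ (Fin N) :=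
    (convex_stdSimplex ℝ (Fin N)) hx' hx (by linarith) hθ0.le (by ring)
  have e2 : y - ((1 - θ) • x' + θ • x) = (0 : ℝ) • v + (1 - θ) • r := by
    ext i
    simp only [hr, hy', Pi.add_apply, Pi.sub_apply, Pi.smul_apply, smul_eq_mul]
    linear_combination (v i) * hθk
  have hm := hmin _ hz
  rw [e1, e2, quad_form G hs v r g _ h hrv, quad_form G hs v _ g _ h (by
    rw [smul_dotProduct, hrv, smul_zero]), hv, mulVec_smul, smul_dotProduct, dotProduct_smul] at hm
  simp only [smul_eq_mul] at hm
  have hq := posdef_nonneg G hG r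
  have : (1 - θ) * ((1 - θ) * (r ⬝ᵥ G *ᵥ r)) ≤ r ⬝ᵥ G *ᵥ r := by
    have : (1 - θ) * (1 - θ) ≤ 1 := by nlinarith
    nlinarith
  have : 0 < (-k) ^ 2 * g * 1 := by
    have : 0 < k ^ 2 * g := by positivity
    nlinarith
  nlinarith

/-- One step in the fast regime. -/
lemma fast_step {N : ℕ} (hN : 0 < N) (G : Matrix (Fin N) (Fin N) ℝ) (hs : G.IsSymm) (hG : G.PosDef)
    (u : Fin N → ℝ) (g η a : ℝ) (hg : 0 < g) (hu : ∀ i, u i = 1 ∨ u i = -1)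
    (hsum : ∑ i, u i = 0) (hfast : g ≤ η * N) (ha0 : 0 ≤ a) (ha1 : a ≤ 1)
    (h : G *ᵥ u = g • u) (x y x' : Fin N → ℝ) (hx : x = fun i => (1 + a * u i) / N)
    (hy : y = x - η • G⁻¹ *ᵥ u)
    (hx' : x' ∈ stdSimplex ℝ (Fin N))
    (hmin : ∀ z ∈ stdSimplex ℝ (Fin N), (y - x') ⬝ᵥ G *ᵥ (y - x') ≤ (y - z) ⬝ᵥ G *ᵥ (y - z)) :
    ∃ a', -1 ≤ a' ∧ a' ≤ a - 1 ∧ x' = fun i => (1 + a' * u i) / N := by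
  have hNp : (0 : ℝ) < N := by exact_mod_cast hN
  have husq : ∀ i, u i * u i = 1 := fun i => by rcases hu i with h | h <;> rw [h] <;> norm_num
  have huu : u ⬝ᵥ u = N := by simp [dotProduct, husq]
  set q := a - η * N / g with hq
  have hkg : 1 ≤ η * N / g := by rw [le_div_iff₀ hg]; linarith
  rw [inv_eig G hG u g hg h] at hy
  have hy' : y = fun i => (1 + q * u i) / N := by
    rw [hy, hx, hq]; ext i; simp; field_simp; ring
  set p := u ⬝ᵥ x' with hp
  have hp1 : -1 ≤ p := by
    have : -1 = ∑ i, -(x' i) := by rw [Finset.sum_neg_distrib, hx'.2]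
    rw [hp, this]
    refine Finset.sum_le_sum fun i _ => ?_
    have := hx'.1 i
    rcases hu i with h | h <;> rw [h] <;> linarith
  set a' := max (-1) q with ha'
  have ha'1 : -1 ≤ a' := le_max_left _ _
  have ha'2 : a' ≤ a - 1 := max_le (by linarith) (by linarith)
  refine ⟨a', ha'1, ha'2, ?_⟩
  set z : Fin N → ℝ := fun i => (1 + a' * u i) / N with hz
  have hzs : z ∈ stdSimplex ℝ (Fin N) := by
    refine ⟨fun i => ?_, ?_⟩
    · refine div_nonneg ?_ hNp.le
      rcases hu i with h | h <;> rw [h] <;> linarith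
    · simp only [hz]
      rw [← Finset.sum_div, Finset.sum_add_distrib, ← Finset.mul_sum, hsum]
      simp [hN.ne']
  set w : Fin N → ℝ := fun i => (1 + p * u i) / N - x' i with hw
  have hwu : w ⬝ᵥ u = 0 := by
    have : w ⬝ᵥ u = (∑ i, (u i + p) / N) - u ⬝ᵥ x' := by
      simp only [dotProduct, hw]
      rw [← Finset.sum_sub_distrib]
      refine Finset.sum_congr rfl fun i _ => ?_
      linear_combination p / N * husq i
    rw [this, ← Finset.sum_div, Finset.sum_add_distrib, hsum, ← hp]
    simp; field_simp; simp
  have e1 : y - x' = ((q - p) / N) • u + w := by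
    rw [hy']; ext i; simp [hw]; ring
  have e2 : y - z = ((q - a') / N) • u + 0 := by
    rw [hy']; ext i; simp [hz]; ring
  have hm := hmin z hzs
  rw [e1, e2, quad_form G hs u w g _ h hwu, quad_form G hs u 0 g _ h (by simp), huu] at hm
  simp only [zero_dotProduct, add_zero] at hm
  have hc : 0 < g / N := by positivity
  have r1 : ∀ b : ℝ, (b / N) ^ 2 * g * N = b ^ 2 * (g / N) := fun b => by field_simp
  rw [r1, r1] at hm
  have hsq : (q - a') ^ 2 ≤ (q - p) ^ 2 := by
    rcases le_total (-1) q with h1 | h1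
    · rw [ha', max_eq_right h1]; nlinarith [sq_nonneg (q - p)]
    · rw [ha', max_eq_left h1]; nlinarith
  have hw0 : w = 0 := by
    by_contra hne
    have := hG.dotProduct_mulVec_pos hne
    simp only [star_trivial] at this
    nlinarith
  have hsq2 : (q - p) ^ 2 ≤ (q - a') ^ 2 := by
    rw [hw0] at hm
    simp only [zero_dotProduct, add_zero] at hm
    exact le_of_mul_le_mul_right hm hc
  have hpa : p = a' := by
    rcases le_total (-1) q with h1 | h1
    · rw [ha', max_eq_right h1] at hsq2 ⊢
      nlinarith [pow_eq_zero_iff (two_ne_zero) |>.mp (le_antisymm (by linarith : (q - p) ^ 2 ≤ 0) (sq_nonneg _))]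
    · rw [ha', max_eq_left h1] at hsq2 ⊢
      have : |q - p| ≤ |q - -1| := sq_le_sq.mp hsq2
      rw [abs_of_nonpos (by linarith), abs_of_nonpos (by linarith)] at this
      linarith
  ext i
  have := congrFun hw0 i
  simp only [hw, Pi.zero_apply, hpa] at this
  simp only [hz]; linarith

lemma rank_one {N T : ℕ} (hT : 0 < T) (c : ℕ → ℝ) (v : Fin N → ℝ) (hc : c 0 ≠ 0) (i : Fin N)
    (hv : v i ≠ 0) :
    (Matrix.of fun (i : Fin N) (t : Fin T) => (c t • v) i).rank = 1 := by
  have : (Matrix.of fun (i : Fin N) (t : Fin T) => (c t • v) i)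
      = vecMulVec v (fun t : Fin T => c t) := by
    ext i t; simp [vecMulVec_apply, mul_comm]
  rw [this]
  refine le_antisymm (rank_vecMulVec_le _ _) ?_
  rw [Nat.one_le_iff_ne_zero]
  intro h0
  have h1 : Module.finrank ℝ (LinearMap.range (vecMulVec v (fun t : Fin T => c t)).mulVecLin) = 0 := h0
  rw [Submodule.finrank_eq_zero, LinearMap.range_eq_bot] at h1
  have h2 := congrFun (LinearMap.congr_fun h1 (Pi.single ⟨0, hT⟩ 1)) i
  simp [vecMulVec_apply] at h2
  tauto

lemma alt_sum (T : ℕ) (a : ℕ → ℝ) (h0 : ∀ t < T, 0 ≤ a t)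
    (h1 : ∀ t, t + 1 < T → 1 ≤ a t + a (t + 1)) :
    ∀ n ≤ T, (n : ℝ) / 2 ≤ ∑ t ∈ Finset.range n, a t + ∑ t ∈ Finset.range n, (-1 : ℝ) ^ t := by
  intro n
  induction n using Nat.twoStepInduction with
  | zero => simp
  | one => intro h; simp; linarith [h0 0 (by omega)]
  | more n ih _ =>
    intro h
    have := ih (by omega)
    have := h1 n (by omega)
    rw [Finset.sum_range_succ, Finset.sum_range_succ, Finset.sum_range_succ (n := n + 1),
      Finset.sum_range_succ (n := n), pow_succ]
    push_cast
    linarith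

lemma A_bound1 (δ : ℝ) (hδ : 0 < δ) (T : ℕ) :
    ∑ t ∈ Finset.range T, 1 / Real.sqrt (δ + (t + 1)) ≤ 2 * Real.sqrt T := by
  induction T with
  | zero => simp
  | succ n ih =>
    rw [Finset.sum_range_succ]
    push_cast
    have hs1 : 0 < Real.sqrt ((n : ℝ) + 1) := Real.sqrt_pos.mpr (by positivity)
    have h1 : 1 / Real.sqrt (δ + (n + 1)) ≤ 1 / Real.sqrt ((n : ℝ) + 1) :=
      one_div_le_one_div_of_le hs1 (Real.sqrt_le_sqrt (by linarith))
    have h2 : 1 / Real.sqrt ((n : ℝ) + 1) ≤ 2 * Real.sqrt ((n : ℝ) + 1) - 2 * Real.sqrt n := by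
      rw [div_le_iff₀ hs1]
      nlinarith [Real.sq_sqrt (by positivity : (0 : ℝ) ≤ n + 1),
        Real.sq_sqrt (by positivity : (0 : ℝ) ≤ n),
        sq_nonneg (Real.sqrt ((n : ℝ) + 1) - Real.sqrt n)]
    linarith

lemma A_bound2 (δ : ℝ) (hδ : 0 < δ) (T : ℕ) :
    (∑ t ∈ Finset.range T, 1 / Real.sqrt (δ + (t + 1))) * Real.sqrt δ ≤ T := by
  rw [Finset.sum_mul]
  calc _ ≤ ∑ t ∈ Finset.range T, (1 : ℝ) := by
        refine Finset.sum_le_sum fun t _ => ?_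
        have : 0 < Real.sqrt (δ + ((t : ℝ) + 1)) := Real.sqrt_pos.mpr (by positivity)
        rw [div_mul_eq_mul_div, one_mul, div_le_one this]
        exact Real.sqrt_le_sqrt (by linarith [(Nat.cast_nonneg t : (0 : ℝ) ≤ t)])
    _ = T := by simp

/-- If the slow regime fails then every fast step is large. -/
lemma fast_cond (N T : ℕ) (hT : 0 < T) (hTlt : (T : ℝ) < Real.sqrt (N : ℝ) / 6) (η δ : ℝ)
    (hδ : 0 < δ)
    (hA : 17 / 36 < η * ∑ t ∈ Finset.range T, 1 / Real.sqrt (δ + (t + 1))) :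
    Real.sqrt (δ + T * N) ≤ η * N := by
  set A := ∑ t ∈ Finset.range T, 1 / Real.sqrt (δ + (t + 1)) with hAd
  have b1 : A ≤ 2 * Real.sqrt T := A_bound1 δ hδ T
  have b2 : A * Real.sqrt δ ≤ T := A_bound2 δ hδ T
  have hA0 : 0 < A := by
    refine Finset.sum_pos (fun t _ => ?_) ⟨0, by simpa using hT⟩
    have : 0 < Real.sqrt (δ + ((t : ℝ) + 1)) := Real.sqrt_pos.mpr (by positivity)
    positivity
  have h1 : Real.sqrt (δ + T * N) ≤ Real.sqrt δ + Real.sqrt T * Real.sqrt N := by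
    rw [← Real.sqrt_mul (by positivity)]
    rw [Real.sqrt_le_left (by positivity)]
    nlinarith [Real.sq_sqrt hδ.le, Real.sq_sqrt (by positivity : (0 : ℝ) ≤ T * N),
      mul_nonneg (Real.sqrt_nonneg δ) (Real.sqrt_nonneg ((T : ℝ) * N))]
  have hT1 : (1 : ℝ) ≤ T := by exact_mod_cast hT
  set s := Real.sqrt N with hs
  have hsN : s ^ 2 = N := Real.sq_sqrt (by positivity)
  have hs6 : 6 < s := by linarith
  have hsT := Real.sq_sqrt (by positivity : (0 : ℝ) ≤ T)
  have hst0 := Real.sqrt_nonneg (T : ℝ)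
  have h2 : A * (Real.sqrt T * s) ≤ 2 * T * s := by
    have : A * Real.sqrt T ≤ 2 * T := by nlinarith
    nlinarith
  have h3 : A * Real.sqrt (δ + T * N) ≤ T + 2 * T * s := by nlinarith
  have h4 : T + 2 * T * s ≤ 17 / 36 * N := by rw [← hsN]; nlinarith
  have h5 : A * Real.sqrt (δ + T * N) ≤ A * (η * N) := by
    have : (0 : ℝ) ≤ N := by positivity
    nlinarith
  exact le_of_mul_le_mul_left h5 hA0

/-- AdaGrad lower bound. There is `N₀` such that for every even `N ≥ N₀`,
every `η > 0`, `δ > 0`, and every positive `T` with `T < √N/6`, there are loss vectors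
`ℓ_0,…,ℓ_{T-1} ∈ [−1,1]^N` of rank-1 loss matrix such that the AdaGrad run
(`x 0 = (1/N)𝟙`, `S 0 = δI`, `S (t+1) = S t + ℓ_tℓ_tᵀ`, `G (t+1)` the unique symmetric
positive definite square root of `S (t+1)`, `y (t+1) = x t − ηG(t+1)⁻¹ℓ_t`, and
`x (t+1)` the `G (t+1)`-projection of `y (t+1)` onto the simplex) has regret `≥ T/2`. -/
theorem stmt12 :
    ∃ N₀ : ℕ, ∀ (N : ℕ) (_hN₀ : N₀ ≤ N) (_hNeven : Even N) (η δ : ℝ)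
      (_hη : 0 < η) (_hδ : 0 < δ) (T : ℕ) (hTpos : 0 < T)
      (hTlt : (T : ℝ) < Real.sqrt (N : ℝ) / 6),
      ∃ ℓ : ℕ → Fin N → ℝ,
        (∀ t < T, ∀ i, |ℓ t i| ≤ 1) ∧
        (Matrix.of fun (i : Fin N) (t : Fin T) => ℓ t i).rank = 1 ∧
        ∀ (S G : ℕ → Matrix (Fin N) (Fin N) ℝ) (y x : ℕ → Fin N → ℝ),
          S 0 = δ • (1 : Matrix (Fin N) (Fin N) ℝ) →
          (∀ t < T, S (t + 1) = S t + vecMulVec (ℓ t) (ℓ t)) →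
          (∀ t < T, (G (t + 1)).IsSymm ∧ (G (t + 1)).PosDef ∧
            G (t + 1) * G (t + 1) = S (t + 1)) →
          (∀ t < T, y (t + 1) = x t - η • (G (t + 1))⁻¹.mulVec (ℓ t)) →
          x 0 = (fun _ => (N : ℝ)⁻¹) →
          (∀ t < T, x (t + 1) ∈ stdSimplex ℝ (Fin N) ∧
            ∀ z ∈ stdSimplex ℝ (Fin N),
              (y (t + 1) - x (t + 1)) ⬝ᵥ (G (t + 1)).mulVec (y (t + 1) - x (t + 1))
                ≤ (y (t + 1) - z) ⬝ᵥ (G (t + 1)).mulVec (y (t + 1) - z)) →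
          (T : ℝ) / 2 ≤
            ∑ t ∈ Finset.range T, ℓ t ⬝ᵥ x t -
              Finset.univ.inf'
                (Finset.univ_nonempty_iff.mpr
                  (Fin.pos_iff_nonempty.mp (by
                    by_contra hN0
                    have hN : N = 0 := by omega
                    rw [hN] at hTlt
                    simp only [Nat.cast_zero, Real.sqrt_zero, zero_div] at hTlt
                    have : (0 : ℝ) < (T : ℝ) := by exact_mod_cast hTpos
                    linarith)))
                (fun i : Fin N => ∑ t ∈ Finset.range T, ℓ t i) := by
  refine ⟨0, ?_⟩
  intro N _ hNeven η δ hη hδ T hTpos hTlt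
  have hT1 : (1 : ℝ) ≤ T := by exact_mod_cast hTpos
  have hs6 : 6 < Real.sqrt (N : ℝ) := by linarith
  have hN36 : (36 : ℝ) < N := by
    have := Real.sq_sqrt (by positivity : (0 : ℝ) ≤ N)
    nlinarith
  have hN : 36 < N := by exact_mod_cast hN36
  by_cases hA : η * ∑ t ∈ Finset.range T, 1 / Real.sqrt (δ + (t + 1)) ≤ 17 / 36
  · -- slow regime
    let i0 : Fin N := ⟨0, by omega⟩
    let v : Fin N → ℝ := Pi.single i0 1
    have hv : v ⬝ᵥ v = 1 := by simp [v]
    refine ⟨fun _ => (-1 : ℝ) • v, ?_, ?_, ?_⟩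
    · intro t _ i
      by_cases h : i = i0
      · subst h; simp [v]
      · simp [v, h]
    · exact rank_one hTpos (fun _ => (-1 : ℝ)) v (by norm_num) i0 (by simp [v])
    · intro S G y x hS0 hS hG hy hx0 hx
      have hGe := G_eig T δ 1 hδ zero_le_one S G v (fun _ => -1) (by norm_num) hv hS0 hS hG
      have hsimp : ∀ t ≤ T, x t ∈ stdSimplex ℝ (Fin N) := by
        intro t ht
        cases t with
        | zero =>
          rw [hx0]
          refine ⟨fun i => by positivity, ?_⟩
          simp; field_simp
        | succ t => exact (hx t (by omega)).1
      have key : ∀ t ≤ T, v ⬝ᵥ x t ≤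
          1 / N + η * ∑ s ∈ Finset.range t, 1 / Real.sqrt (δ + (s + 1)) := by
        intro t
        induction t with
        | zero => intro _; rw [hx0]; simp [v]
        | succ t ih =>
          intro ht
          have h1 := ih (by omega)
          have hp : 0 < Real.sqrt (δ + ((t : ℝ) + 1) * 1) := Real.sqrt_pos.mpr (by positivity)
          have h2 := slow_step (G (t + 1)) (hG t ht).1 (hG t ht).2.1 v _ η hp hη hv (hGe t ht)
            (x t) (y (t + 1)) (x (t + 1)) (hsimp t (by omega)) (hy t ht) (hx t ht).1 (hx t ht).2
          rw [Finset.sum_range_succ, mul_add]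
          rw [mul_one] at h2
          have : η * (1 / Real.sqrt (δ + ((t : ℝ) + 1))) = η / Real.sqrt (δ + ((t : ℝ) + 1)) := by
            ring
          linarith
      have key2 : ∀ t ∈ Finset.range T, (-1 / 2 : ℝ) ≤ ((-1 : ℝ) • v) ⬝ᵥ x t := by
        intro t ht
        have ht := Finset.mem_range.mp ht
        have h1 := key t ht.le
        have h2 : ∑ s ∈ Finset.range t, 1 / Real.sqrt (δ + (s + 1)) ≤
            ∑ s ∈ Finset.range T, 1 / Real.sqrt (δ + (s + 1)) := by
          refine Finset.sum_le_sum_of_subset_of_nonneg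
            (Finset.range_mono ht.le) fun i _ _ => by positivity
        have h3 := mul_le_mul_of_nonneg_left h2 hη.le
        have h4 : 1 / (N : ℝ) ≤ 1 / 36 := one_div_le_one_div_of_le (by norm_num) hN36.le
        rw [smul_dotProduct, smul_eq_mul]
        linarith
      have h5 := Finset.sum_le_sum key2
      rw [Finset.sum_const, Finset.card_range, nsmul_eq_mul] at h5
      have h6 := Finset.inf'_le (s := Finset.univ)
        (fun i : Fin N => ∑ t ∈ Finset.range T, ((-1 : ℝ) • v) i) (Finset.mem_univ i0)
      have h7 : ∑ t ∈ Finset.range T, ((-1 : ℝ) • v) i0 = -T := by simp [v]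
      simp only [h7] at h6
      linarith
  · -- fast regime
    push Not at hA
    have hfast := fast_cond N T hTpos hTlt η δ hδ hA
    let v : Fin N → ℝ := fun i => (-1 : ℝ) ^ (i : ℕ)
    have hv1 : ∀ i, v i = 1 ∨ v i = -1 := fun i => neg_one_pow_eq_or ℝ _
    have hvsum : ∑ i, v i = 0 := by
      simp only [v]
      rw [Fin.sum_univ_eq_sum_range (fun i => (-1 : ℝ) ^ i) N, neg_one_geom_sum, if_pos hNeven]
    have hvsq : ∀ i, v i * v i = 1 := fun i => by
      rcases hv1 i with h | h <;> rw [h] <;> norm_num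
    have hvv : v ⬝ᵥ v = N := by simp [dotProduct, hvsq]
    let c : ℕ → ℝ := fun t => (-1 : ℝ) ^ t
    have hc1 : ∀ t, c t = 1 ∨ c t = -1 := fun t => neg_one_pow_eq_or ℝ t
    have hcsq : ∀ t, c t ^ 2 = 1 := fun t => by
      rcases hc1 t with h | h <;> rw [h] <;> norm_num
    have hcs : ∀ t, c (t + 1) = -c t := fun t => by simp [c, pow_succ]
    let i1 : Fin N := ⟨1, by omega⟩
    have hu1 : ∀ t i, (c t • v) i = 1 ∨ (c t • v) i = -1 := by
      intro t i
      simp only [Pi.smul_apply, smul_eq_mul]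
      rcases hc1 t with h | h <;> rcases hv1 i with h' | h' <;> rw [h, h'] <;> norm_num
    have husum : ∀ t, ∑ i, (c t • v) i = 0 := by
      intro t
      simp only [Pi.smul_apply, smul_eq_mul]
      rw [← Finset.mul_sum, hvsum, mul_zero]
    refine ⟨fun t => c t • v, ?_, ?_, ?_⟩
    · intro t _ i
      rcases hu1 t i with h | h <;> simp only [h] <;> norm_num
    · exact rank_one hTpos c v (by simp [c]) i1 (by simp [v, i1])
    · intro S G y x hS0 hS hG hy hx0 hx
      have hGe := G_eig T δ N hδ (by positivity) S G v c hcsq hvv hS0 hS hG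
      have step : ∀ t < T, ∀ a : ℝ, 0 ≤ a → a ≤ 1 →
          (x t = fun i => (1 + a * (c t • v) i) / N) →
          ∃ b : ℝ, 0 ≤ b ∧ b ≤ 1 ∧ 1 ≤ a + b ∧
            (x (t + 1) = fun i => (1 + b * (c (t + 1) • v) i) / N) := by
        intro t ht a ha0 ha1 hxa
        have hp : 0 < Real.sqrt (δ + ((t : ℝ) + 1) * N) := Real.sqrt_pos.mpr (by positivity)
        have hle : Real.sqrt (δ + ((t : ℝ) + 1) * N) ≤ η * N := by
          refine le_trans (Real.sqrt_le_sqrt ?_) hfast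
          have : (t : ℝ) + 1 ≤ T := by exact_mod_cast ht
          have : ((t : ℝ) + 1) * N ≤ T * N := by gcongr
          linarith
        have hGu : G (t + 1) *ᵥ (c t • v) = Real.sqrt (δ + ((t : ℝ) + 1) * N) • (c t • v) := by
          rw [mulVec_smul, hGe t ht, smul_comm]
        obtain ⟨a', h1, h2, h3⟩ := fast_step (by omega) (G (t + 1)) (hG t ht).1 (hG t ht).2.1
          (c t • v) _ η a hp (hu1 t) (husum t) hle ha0 ha1 hGu (x t) (y (t + 1)) (x (t + 1))
          hxa (hy t ht) (hx t ht).1 (hx t ht).2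
        refine ⟨-a', by linarith, by linarith, by linarith, ?_⟩
        rw [h3, hcs]
        ext i
        simp
      have dot : ∀ t (a : ℝ), (x t = fun i => (1 + a * (c t • v) i) / N) →
          (c t • v) ⬝ᵥ x t = a := by
        intro t a h
        have husq : ∀ i, (c t • v) i * (c t • v) i = 1 := fun i => by
          rcases hu1 t i with h | h <;> rw [h] <;> norm_num
        have : (c t • v) ⬝ᵥ x t = ∑ i, ((c t • v) i + a) / N := by
          rw [h]
          refine Finset.sum_congr rfl fun i _ => ?_
          linear_combination a / N * husq i
        rw [this, ← Finset.sum_div, Finset.sum_add_distrib, husum]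
        simp only [Finset.sum_const, Finset.card_univ, Fintype.card_fin, nsmul_eq_mul, zero_add]
        field_simp
      have inv : ∀ t ≤ T, ∃ a : ℝ, 0 ≤ a ∧ a ≤ 1 ∧
          (x t = fun i => (1 + a * (c t • v) i) / N) := by
        intro t
        induction t with
        | zero => intro _; exact ⟨0, le_rfl, zero_le_one, by rw [hx0]; ext i; simp⟩
        | succ t ih =>
          intro ht
          obtain ⟨a, h0, h1, h2⟩ := ih (by omega)
          obtain ⟨b, h3, h4, _, h5⟩ := step t ht a h0 h1 h2
          exact ⟨b, h3, h4, h5⟩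
      have hsum := alt_sum T (fun t => (c t • v) ⬝ᵥ x t)
        (fun t ht => by
          obtain ⟨a, h0, h1, h2⟩ := inv t ht.le
          simpa only [dot t a h2] using h0)
        (fun t ht => by
          obtain ⟨a, h0, h1, h2⟩ := inv t (by omega)
          obtain ⟨b, h3, h4, h6, h5⟩ := step t (by omega) a h0 h1 h2
          simpa only [dot t a h2, dot (t + 1) b h5] using h6) T le_rfl
      have h6 := Finset.inf'_le (s := Finset.univ)
        (fun i : Fin N => ∑ t ∈ Finset.range T, (c t • v) i) (Finset.mem_univ i1)
      have h7 : ∑ t ∈ Finset.range T, (c t • v) i1 = -∑ t ∈ Finset.range T, (-1 : ℝ) ^ t := by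
        simp [v, c, i1]
      simp only [h7] at h6
      linarith
end

section
/- There exists N₀ such that for every even N ≥ N₀, every η > 0, every δ > 0, and every positive integer T with T ≤ max( 1/(36η²) + 2√δ/(6η), η²N − δ ), there exists a sequence of loss vectors ℓ₁,…,ℓ_T ∈ [−1,1]^N whose loss matrix has rank 1, such that the AdaGrad iterates x₁,…,x_T defined by x₁ = (1/N)𝟙, S₀ = δI_N, S_t = S_{t−1} + ℓ_tℓ_tᵀ, G_t = S_t^{1/2} (the unique symmetric positive definite square root), y_{t+1} = x_t − ηG_t⁻¹ℓ_t, and x_{t+1} = argmin_{x ∈ Δ_N} (y_{t+1}−x)ᵀG_t(y_{t+1}−x), satisfy Σ_{t=1}^T x_t·ℓ_t − min_{i∈[N]} Σ_{t=1}^T ℓ_t(i) ≥ T/2. -/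
open Matrix

theorem ag_eig {N : ℕ} (G S : Matrix (Fin N) (Fin N) ℝ) (hG : G.PosDef) (hGS : G * G = S)
    (v : Fin N → ℝ) (μ : ℝ) (hμ : 0 < μ) (hv : S.mulVec v = (μ ^ 2) • v) :
    G.mulVec v = μ • v := by
  by_contra hne
  have hw : G.mulVec v - μ • v ≠ 0 := sub_ne_zero.mpr hne
  have h1 : G.mulVec (G.mulVec v - μ • v) = (-μ) • (G.mulVec v - μ • v) := by
    rw [Matrix.mulVec_sub, Matrix.mulVec_mulVec, hGS, hv, Matrix.mulVec_smul]
    ext i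
    simp only [Pi.sub_apply, Pi.smul_apply, smul_eq_mul]
    ring
  have h2 := hG.dotProduct_mulVec_pos hw
  rw [h1] at h2
  simp only [star_trivial, dotProduct_smul, smul_eq_mul] at h2
  have h3 : 0 ≤ (G.mulVec v - μ • v) ⬝ᵥ (G.mulVec v - μ • v) :=
    Finset.sum_nonneg fun i _ => mul_self_nonneg _
  nlinarith

theorem ag_symm {N : ℕ} (G : Matrix (Fin N) (Fin N) ℝ) (hs : G.IsSymm) (a b : Fin N → ℝ) :
    a ⬝ᵥ G.mulVec b = b ⬝ᵥ G.mulVec a := by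
  rw [Matrix.dotProduct_mulVec, ← Matrix.mulVec_transpose, hs.eq, dotProduct_comm]

theorem ag_vi {N : ℕ} (G : Matrix (Fin N) (Fin N) ℝ) (hs : G.IsSymm) (hG : G.PosDef)
    (y x : Fin N → ℝ) (hx : x ∈ stdSimplex ℝ (Fin N))
    (hmin : ∀ z ∈ stdSimplex ℝ (Fin N),
      (y - x) ⬝ᵥ G.mulVec (y - x) ≤ (y - z) ⬝ᵥ G.mulVec (y - z))
    (z : Fin N → ℝ) (hz : z ∈ stdSimplex ℝ (Fin N)) :
    0 ≤ (z - x) ⬝ᵥ G.mulVec (x - y) := by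
  by_contra hb
  push Not at hb
  set b := (z - x) ⬝ᵥ G.mulVec (x - y) with hbdef
  have hc : 0 ≤ (z - x) ⬝ᵥ G.mulVec (z - x) := by
    simpa using hG.posSemidef.dotProduct_mulVec_nonneg (z - x)
  set c := (z - x) ⬝ᵥ G.mulVec (z - x) with hcdef
  have key : ∀ ε : ℝ, 0 ≤ ε → ε ≤ 1 → 0 ≤ 2 * ε * b + ε ^ 2 * c := by
    intro ε h0 h1
    have hm := hmin ((1 - ε) • x + ε • z)
      (convex_stdSimplex ℝ (Fin N) hx hz (by linarith) h0 (by ring))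
    have e : y - ((1 - ε) • x + ε • z) = (y - x) - ε • (z - x) := by
      ext i
      simp only [Pi.sub_apply, Pi.add_apply, Pi.smul_apply, smul_eq_mul]
      ring
    have hb2 : b = - ((z - x) ⬝ᵥ G.mulVec (y - x)) := by
      rw [hbdef, ← neg_sub y x, Matrix.mulVec_neg, dotProduct_neg]
    have hsym := ag_symm G hs (y - x) (z - x)
    rw [e] at hm
    simp only [Matrix.mulVec_sub G (y - x), Matrix.mulVec_smul, sub_dotProduct (y - x),
      dotProduct_sub _ (G.mulVec (y - x)), smul_dotProduct, dotProduct_smul, smul_eq_mul] at hm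
    rw [hsym, ← hcdef] at hm
    rw [hb2]
    nlinarith
  have hcb : 0 < c - b := by linarith
  have h := key (-b / (c - b)) (div_nonneg (by linarith) hcb.le) (by rw [div_le_one hcb]; linarith)
  have e2 : 2 * (-b / (c - b)) * b + (-b / (c - b)) ^ 2 * c
      = (b ^ 2 / (c - b) ^ 2) * (2 * b - c) := by
    field_simp
    ring
  rw [e2] at h
  have : 0 < b ^ 2 / (c - b) ^ 2 := div_pos (by nlinarith) (by positivity)
  nlinarith

theorem ag_S {N : ℕ} (v : Fin N → ℝ) (s : ℕ → ℝ) (hs : ∀ t, s t * s t = 1) (δ : ℝ) (T : ℕ)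
    (S : ℕ → Matrix (Fin N) (Fin N) ℝ) (h0 : S 0 = δ • (1 : Matrix (Fin N) (Fin N) ℝ))
    (hS : ∀ t < T, S (t + 1) = S t + vecMulVec (s t • v) (s t • v)) :
    ∀ t ≤ T, (S t).mulVec v = (δ + t * (v ⬝ᵥ v)) • v := by
  intro t
  induction t with
  | zero => intro _; rw [h0, Matrix.smul_mulVec, Matrix.one_mulVec]; simp
  | succ t ih =>
    intro ht
    rw [hS t (by omega), Matrix.add_mulVec, ih (by omega), Matrix.vecMulVec_mulVec]
    ext i
    have := hs t
    simp only [Pi.add_apply, Pi.smul_apply, smul_eq_mul, smul_dotProduct, op_smul_eq_smul]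
    push_cast
    linear_combination (v ⬝ᵥ v) * v i * this

/-- One AdaGrad step: eigenvector property of `G` and the variational inequality. -/
theorem ag_step {N : ℕ} (v : Fin N → ℝ) (hv : 0 ≤ v ⬝ᵥ v) (s : ℕ → ℝ)
    (hs : ∀ t, s t * s t = 1)
    (η δ : ℝ) (hδ : 0 < δ) (T : ℕ)
    (S G : ℕ → Matrix (Fin N) (Fin N) ℝ) (y x : ℕ → Fin N → ℝ)
    (h0 : S 0 = δ • (1 : Matrix (Fin N) (Fin N) ℝ))
    (hS : ∀ t < T, S (t + 1) = S t + vecMulVec (s t • v) (s t • v))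
    (hG : ∀ t < T, (G (t + 1)).IsSymm ∧ (G (t + 1)).PosDef ∧
            G (t + 1) * G (t + 1) = S (t + 1))
    (hy : ∀ t < T, y (t + 1) = x t - η • (G (t + 1))⁻¹.mulVec (s t • v))
    (hx : ∀ t < T, x (t + 1) ∈ stdSimplex ℝ (Fin N) ∧
            ∀ z ∈ stdSimplex ℝ (Fin N),
              (y (t + 1) - x (t + 1)) ⬝ᵥ (G (t + 1)).mulVec (y (t + 1) - x (t + 1))
                ≤ (y (t + 1) - z) ⬝ᵥ (G (t + 1)).mulVec (y (t + 1) - z))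
    (t : ℕ) (ht : t < T) :
    (G (t + 1)).mulVec v = Real.sqrt (δ + ((t + 1 : ℕ) : ℝ) * (v ⬝ᵥ v)) • v ∧
    ∀ z ∈ stdSimplex ℝ (Fin N),
      0 ≤ (z - x (t + 1)) ⬝ᵥ ((G (t + 1)).mulVec (x (t + 1) - x t) + (η * s t) • v) := by
  obtain ⟨hsym, hpd, hsq⟩ := hG t ht
  have hpos : 0 < δ + ((t + 1 : ℕ) : ℝ) * (v ⬝ᵥ v) := by positivity
  refine ⟨ag_eig _ _ hpd hsq v _ (Real.sqrt_pos.mpr hpos) ?_, ?_⟩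
  · rw [Real.sq_sqrt hpos.le]
    exact ag_S v s hs δ T S h0 hS (t + 1) ht
  · intro z hz
    have h := ag_vi _ hsym hpd (y (t + 1)) (x (t + 1)) (hx t ht).1 (hx t ht).2 z hz
    have e : (G (t + 1)).mulVec (x (t + 1) - y (t + 1))
        = (G (t + 1)).mulVec (x (t + 1) - x t) + (η * s t) • v := by
      have hu : IsUnit (G (t + 1)).det := (Matrix.isUnit_iff_isUnit_det _).mp hpd.isUnit
      rw [hy t ht, ← sub_add, Matrix.mulVec_add, Matrix.mulVec_smul, Matrix.mulVec_mulVec,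
        Matrix.mul_nonsing_inv _ hu, Matrix.one_mulVec, smul_smul]
    rwa [e] at h

theorem ag_rank {N T : ℕ} (v : Fin N → ℝ) (s : ℕ → ℝ) (hs : ∀ t, s t * s t = 1) (hT : 0 < T)
    (i : Fin N) (hi : v i ≠ 0) :
    (Matrix.of fun (i : Fin N) (t : Fin T) => (s t • v) i).rank = 1 := by
  have e : (Matrix.of fun (i : Fin N) (t : Fin T) => (s t • v) i)
      = vecMulVec v (fun t : Fin T => s t) := by
    ext i t
    simp [vecMulVec_apply, mul_comm]
  rw [e]
  apply le_antisymm (Matrix.rank_vecMulVec_le _ _)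
  rw [Nat.one_le_iff_ne_zero]
  intro h
  have h : vecMulVec v (fun t : Fin T => s t) = 0 := by
    rw [Matrix.rank, Submodule.finrank_eq_zero, LinearMap.range_eq_bot] at h
    ext j k
    have h4 := congrFun (LinearMap.congr_fun h (Pi.single k 1)) j
    rw [Matrix.mulVecLin_apply, Matrix.mulVec_single_one] at h4
    simpa using h4
  have h2 := congrFun (congrFun h i) ⟨0, hT⟩
  simp only [vecMulVec_apply, Matrix.zero_apply] at h2
  have := hs 0
  rcases mul_eq_zero.mp h2 with h3 | h3
  · exact hi h3
  · rw [h3] at this; simp at this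

/-- Slow regime. -/
theorem ag_slow {N : ℕ} (hN : 6 ≤ N) (i₀ : Fin N)
    (η δ : ℝ) (hη : 0 < η) (hδ : 0 < δ) (T : ℕ)
    (hT : (T : ℝ) ≤ 1 / (36 * η ^ 2) + 2 * Real.sqrt δ / (6 * η))
    (S G : ℕ → Matrix (Fin N) (Fin N) ℝ) (y x : ℕ → Fin N → ℝ)
    (h0 : S 0 = δ • (1 : Matrix (Fin N) (Fin N) ℝ))
    (hS : ∀ t < T, S (t + 1) = S t +
      vecMulVec ((-1 : ℝ) • Pi.single i₀ (1 : ℝ)) ((-1 : ℝ) • Pi.single i₀ (1 : ℝ)))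
    (hG : ∀ t < T, (G (t + 1)).IsSymm ∧ (G (t + 1)).PosDef ∧
            G (t + 1) * G (t + 1) = S (t + 1))
    (hy : ∀ t < T, y (t + 1) = x t -
      η • (G (t + 1))⁻¹.mulVec ((-1 : ℝ) • Pi.single i₀ (1 : ℝ)))
    (hx0 : x 0 = (fun _ => (N : ℝ)⁻¹))
    (hx : ∀ t < T, x (t + 1) ∈ stdSimplex ℝ (Fin N) ∧
            ∀ z ∈ stdSimplex ℝ (Fin N),
              (y (t + 1) - x (t + 1)) ⬝ᵥ (G (t + 1)).mulVec (y (t + 1) - x (t + 1))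
                ≤ (y (t + 1) - z) ⬝ᵥ (G (t + 1)).mulVec (y (t + 1) - z)) :
    ∀ t ≤ T, x t i₀ ≤ 1 / 2 := by
  have hN6 : (6 : ℝ) ≤ N := by exact_mod_cast hN
  have hsimp : ∀ t ≤ T, x t ∈ stdSimplex ℝ (Fin N) := by
    intro t ht
    cases t with
    | zero =>
      rw [hx0]
      refine ⟨fun _ => by positivity, ?_⟩
      simp only [Finset.sum_const, Finset.card_univ, Fintype.card_fin, nsmul_eq_mul]
      exact mul_inv_cancel₀ (by positivity)
    | succ t => exact (hx t ht).1
  have hvv : (Pi.single i₀ (1 : ℝ) : Fin N → ℝ) ⬝ᵥ Pi.single i₀ (1 : ℝ) = 1 := by simp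
  have main : ∀ t ≤ T, x t i₀ ≤ (N : ℝ)⁻¹ + 2 * η * (Real.sqrt (δ + t) - Real.sqrt δ) := by
    intro t
    induction t with
    | zero => intro _; rw [hx0]; simp
    | succ t ih =>
      intro ht
      have ih := ih (by omega)
      obtain ⟨hGv, hvi⟩ := ag_step (Pi.single i₀ (1 : ℝ)) (by rw [hvv]; norm_num)
        (fun _ => -1) (by intro; norm_num) η δ hδ T S G y x h0 hS hG hy hx t (by omega)
      have hvi := hvi (x t) (hsimp t (by omega))
      rw [hvv, mul_one] at hGv
      set μ := Real.sqrt (δ + ((t + 1 : ℕ) : ℝ)) with hμ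
      have hμpos : 0 < μ := Real.sqrt_pos.mpr (by positivity)
      set d := x (t + 1) - x t with hd
      have hd1 : x t - x (t + 1) = -d := by rw [hd]; abel
      rw [hd1, dotProduct_add, neg_dotProduct, neg_dotProduct, dotProduct_smul,
        dotProduct_single] at hvi
      have hsym := (hG t (by omega)).1
      have hq : μ * d i₀ ^ 2 ≤ d ⬝ᵥ (G (t + 1)).mulVec d := by
        have hr := (hG t (by omega)).2.1.posSemidef.dotProduct_mulVec_nonneg
          (d - d i₀ • Pi.single i₀ (1 : ℝ))
        simp only [star_trivial, Matrix.mulVec_sub, Matrix.mulVec_smul, hGv, sub_dotProduct,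
          dotProduct_sub, smul_dotProduct, dotProduct_smul, smul_eq_mul,
          ag_symm _ hsym (Pi.single i₀ (1 : ℝ)) d, dotProduct_single, Pi.sub_apply, Pi.smul_apply,
          Pi.single_eq_same] at hr
        nlinarith
      simp only [smul_eq_mul] at hvi
      have hdb : d i₀ * μ ≤ η := by
        by_contra hcon
        push Not at hcon
        have : 0 < d i₀ := by
          by_contra hneg
          push Not at hneg
          nlinarith
        nlinarith
      have hxd : x (t + 1) i₀ = x t i₀ + d i₀ := by rw [hd]; simp
      set ν := Real.sqrt (δ + t) with hν
      have hν0 : 0 ≤ ν := Real.sqrt_nonneg _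
      have hμ2 : μ ^ 2 = δ + (t + 1) := by
        rw [hμ, Real.sq_sqrt (by positivity)]; push_cast; ring
      have hν2 : ν ^ 2 = δ + t := by rw [hν, Real.sq_sqrt (by positivity)]
      have hle : ν ≤ μ := by nlinarith
      have h1 : 1 ≤ 2 * μ * (μ - ν) := by nlinarith
      have h2 : d i₀ ≤ 2 * η * (μ - ν) := by
        have : d i₀ * μ ≤ (2 * η * (μ - ν)) * μ := by nlinarith
        exact le_of_mul_le_mul_right this hμpos
      rw [hxd]
      linarith
  intro t ht
  have h1 := main t ht
  have h2 : (N : ℝ)⁻¹ ≤ 1 / 6 := by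
    rw [inv_eq_one_div]; exact one_div_le_one_div_of_le (by norm_num) hN6
  have h3 : Real.sqrt (δ + t) ≤ Real.sqrt δ + 1 / (6 * η) := by
    apply Real.sqrt_le_iff.mpr
    refine ⟨by positivity, ?_⟩
    have htT : (t : ℝ) ≤ T := by exact_mod_cast ht
    have e : (Real.sqrt δ + 1 / (6 * η)) ^ 2
        = δ + (1 / (36 * η ^ 2) + 2 * Real.sqrt δ / (6 * η)) := by
      rw [add_sq, Real.sq_sqrt hδ.le]
      field_simp
      ring
    rw [e]; linarith
  have h4 : 2 * η * (Real.sqrt (δ + t) - Real.sqrt δ) ≤ 2 * η * (1 / (6 * η)) := by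
    apply mul_le_mul_of_nonneg_left _ (by positivity)
    linarith
  have h5 : 2 * η * (1 / (6 * η)) = 1 / 3 := by field_simp; norm_num
  linarith

theorem ag_vbound {N : ℕ} (v : Fin N → ℝ) (hv : ∀ i, |v i| ≤ 1) (x : Fin N → ℝ)
    (hx : x ∈ stdSimplex ℝ (Fin N)) : |v ⬝ᵥ x| ≤ 1 := by
  calc |v ⬝ᵥ x| ≤ ∑ i, |v i * x i| := Finset.abs_sum_le_sum_abs _ _
    _ ≤ ∑ i, x i := by
        apply Finset.sum_le_sum
        intro i _
        rw [abs_mul, abs_of_nonneg (hx.1 i)]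
        have := hv i
        have := hx.1 i
        nlinarith
    _ = 1 := hx.2

/-- Fast regime. -/
theorem ag_fast {N : ℕ} (hN : 0 < N) (v : Fin N → ℝ) (hv1 : ∀ i, |v i| ≤ 1)
    (hvv : v ⬝ᵥ v = N) (hvs : ∑ i, v i = 0)
    (η δ : ℝ) (hη : 0 < η) (hδ : 0 < δ) (T : ℕ)
    (hT : (T : ℝ) ≤ η ^ 2 * (N : ℝ) - δ)
    (S G : ℕ → Matrix (Fin N) (Fin N) ℝ) (y x : ℕ → Fin N → ℝ)
    (h0 : S 0 = δ • (1 : Matrix (Fin N) (Fin N) ℝ))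
    (hS : ∀ t < T, S (t + 1) = S t + vecMulVec ((-1 : ℝ) ^ t • v) ((-1 : ℝ) ^ t • v))
    (hG : ∀ t < T, (G (t + 1)).IsSymm ∧ (G (t + 1)).PosDef ∧
            G (t + 1) * G (t + 1) = S (t + 1))
    (hy : ∀ t < T, y (t + 1) = x t - η • (G (t + 1))⁻¹.mulVec ((-1 : ℝ) ^ t • v))
    (hx0 : x 0 = (fun _ => (N : ℝ)⁻¹))
    (hx : ∀ t < T, x (t + 1) ∈ stdSimplex ℝ (Fin N) ∧
            ∀ z ∈ stdSimplex ℝ (Fin N),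
              (y (t + 1) - x (t + 1)) ⬝ᵥ (G (t + 1)).mulVec (y (t + 1) - x (t + 1))
                ≤ (y (t + 1) - z) ⬝ᵥ (G (t + 1)).mulVec (y (t + 1) - z)) :
    ∃ g : ℕ → ℝ, g 0 = 0 ∧ (∀ t ≤ T, 0 ≤ g t) ∧ (∀ t < T, 1 ≤ g t + g (t + 1)) ∧
      ∀ t ≤ T, ((-1 : ℝ) ^ t • v) ⬝ᵥ x t = g t := by
  have hNr : (1 : ℝ) ≤ N := by exact_mod_cast hN
  have hN0 : (N : ℝ) ≠ 0 := by positivity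
  have hss : ∀ t : ℕ, (-1 : ℝ) ^ t * (-1 : ℝ) ^ t = 1 := by
    intro t; rw [← mul_pow]; simp
  -- the two-valued family
  have hfam : ∀ f : ℝ, |f| ≤ 1 → (fun i => (N : ℝ)⁻¹ * (1 + f * v i)) ∈ stdSimplex ℝ (Fin N) := by
    intro f hf
    constructor
    · intro i
      have h1 : |f * v i| ≤ 1 := by
        rw [abs_mul]; exact mul_le_one₀ hf (abs_nonneg _) (hv1 i)
      have := (abs_le.mp h1).1
      apply mul_nonneg (by positivity); linarith
    · rw [← Finset.mul_sum, Finset.sum_add_distrib, ← Finset.mul_sum, hvs]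
      simp [hN0]
  have hvf : ∀ f : ℝ, v ⬝ᵥ (fun i => (N : ℝ)⁻¹ * (1 + f * v i)) = f := by
    intro f
    have : v ⬝ᵥ (fun i => (N : ℝ)⁻¹ * (1 + f * v i))
        = (N : ℝ)⁻¹ * (∑ i, v i + f * (v ⬝ᵥ v)) := by
      simp only [dotProduct, Finset.mul_sum, ← Finset.sum_add_distrib]
      apply Finset.sum_congr rfl
      intro i _; ring
    rw [this, hvs, hvv]; field_simp; ring
  set a : ℕ → ℝ := fun t => N * η / Real.sqrt (δ + ((t + 1 : ℕ) : ℝ) * N) with ha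
  have ha1 : ∀ t < T, 1 ≤ a t := by
    intro t ht
    have hp : 0 < Real.sqrt (δ + ((t + 1 : ℕ) : ℝ) * N) := Real.sqrt_pos.mpr (by positivity)
    simp only [ha]
    rw [one_le_div hp]
    apply Real.sqrt_le_iff.mpr
    refine ⟨by positivity, ?_⟩
    have htT : ((t + 1 : ℕ) : ℝ) ≤ T := by exact_mod_cast ht
    have h1 : (((t + 1 : ℕ) : ℝ) + δ) * N ≤ (η ^ 2 * N) * N :=
      mul_le_mul_of_nonneg_right (by linarith) (by positivity)
    nlinarith
  let g : ℕ → ℝ := fun t => Nat.rec 0 (fun t r => min 1 (a t - r)) t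
  have hg0 : g 0 = 0 := rfl
  have hgs : ∀ t, g (t + 1) = min 1 (a t - g t) := fun t => rfl
  have hgle : ∀ t, g t ≤ 1 := by
    intro t
    cases t with
    | zero => rw [hg0]; norm_num
    | succ t => rw [hgs]; exact min_le_left _ _
  have hgn : ∀ t ≤ T, 0 ≤ g t := by
    intro t ht
    cases t with
    | zero => rw [hg0]
    | succ t =>
      rw [hgs]
      have := ha1 t ht
      have := hgle t
      exact le_min (by norm_num) (by linarith)
  refine ⟨g, hg0, hgn, ?_, ?_⟩
  · intro t ht
    have h1 := ha1 t ht
    have h2 := hgn t ht.le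
    have h3 := hgs t
    rcases min_choice 1 (a t - g t) with h | h <;> rw [h3, h] <;> linarith
  have hform : ∀ t ≤ T, x t = fun i => (N : ℝ)⁻¹ * (1 + ((-1 : ℝ) ^ t * g t) * v i) := by
    intro t
    induction t with
    | zero => intro _; rw [hx0, hg0]; simp
    | succ t ih =>
      intro ht
      have ih := ih (by omega)
      obtain ⟨hGv, hvi⟩ := ag_step v (by rw [hvv]; positivity)
        (fun t => (-1 : ℝ) ^ t) hss η δ hδ T S G y x h0 hS hG hy hx t ht
      rw [hvv] at hGv
      have hμpos : 0 < Real.sqrt (δ + ((t + 1 : ℕ) : ℝ) * N) := Real.sqrt_pos.mpr (by positivity)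
      have hat : a t * Real.sqrt (δ + ((t + 1 : ℕ) : ℝ) * N) = N * η := by
        simp only [ha]; field_simp
      set μ := Real.sqrt (δ + ((t + 1 : ℕ) : ℝ) * N) with hμ
      set f' := (-1 : ℝ) ^ (t + 1) * g (t + 1) with hf'
      have hf'1 : |f'| ≤ 1 := by
        rw [hf', abs_mul, abs_pow, abs_neg, abs_one, one_pow, one_mul,
          abs_of_nonneg (hgn _ ht)]
        exact hgle (t + 1)
      set u : Fin N → ℝ := fun i => (N : ℝ)⁻¹ * (1 + f' * v i) with hu
      have hus := hfam f' hf'1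
      have hvu := hvf f'
      have h1 := hvi u hus
      have hpd := (hG t (by omega)).2.1
      -- variational inequality for the candidate
      have hux : u - x t = ((N : ℝ)⁻¹ * (f' - (-1 : ℝ) ^ t * g t)) • v := by
        rw [ih]; ext i
        simp only [hu, Pi.sub_apply, Pi.smul_apply, smul_eq_mul]; ring
      have hGu : (G (t + 1)).mulVec (u - x t) + (η * (-1 : ℝ) ^ t) • v
          = ((N : ℝ)⁻¹ * (f' - (-1 : ℝ) ^ t * g t) * μ + η * (-1 : ℝ) ^ t) • v := by
        rw [hux, Matrix.mulVec_smul, hGv, smul_smul, ← add_smul]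
      have h2 : 0 ≤ (x (t + 1) - u) ⬝ᵥ
          ((G (t + 1)).mulVec (u - x t) + (η * (-1 : ℝ) ^ t) • v) := by
        rw [hGu, dotProduct_smul, sub_dotProduct, dotProduct_comm _ v, dotProduct_comm _ v, hvu,
          smul_eq_mul]
        have hb := abs_le.mp (ag_vbound v hv1 (x (t + 1)) (hx t ht).1)
        set w := v ⬝ᵥ x (t + 1) with hw
        have e : (N : ℝ)⁻¹ * (f' - (-1 : ℝ) ^ t * g t) * μ + η * (-1 : ℝ) ^ t
            = (-1 : ℝ) ^ t * ((N : ℝ)⁻¹ * μ * (a t - g t - g (t + 1))) := by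
          rw [hf', pow_succ]
          have : η = (N : ℝ)⁻¹ * (a t * μ) := by rw [hat]; field_simp
          rw [this]; ring
        rw [e]
        have hst : 0 ≤ (N : ℝ)⁻¹ * μ := by positivity
        rcases min_choice 1 (a t - g t) with h | h
        · have hg1 : g (t + 1) = 1 := by rw [hgs, h]
          have hge : 0 ≤ a t - g t - 1 := by have := min_eq_left_iff.mp h; linarith
          rw [hf', hg1, pow_succ]
          have e3 : (-1 : ℝ) ^ t * ((N : ℝ)⁻¹ * μ * (a t - g t - 1)) *
              (w - (-1 : ℝ) ^ t * -1 * 1)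
              = ((N : ℝ)⁻¹ * μ) * (a t - g t - 1) * ((-1 : ℝ) ^ t * w + 1) := by
            linear_combination ((N : ℝ)⁻¹ * μ * (a t - g t - 1)) * hss t
          rw [e3]
          apply mul_nonneg (mul_nonneg hst hge)
          rcases neg_one_pow_eq_or ℝ t with h | h <;> rw [h] <;> linarith
        · rw [hgs, h]; simp
      have hzero : ¬ (x (t + 1) - u ≠ 0) := by
        intro hne
        have h3 := hpd.dotProduct_mulVec_pos hne
        have e : x (t + 1) - u = (x (t + 1) - x t) - (u - x t) := by abel
        have e4 : (x (t + 1) - u) ⬝ᵥ (G (t + 1)).mulVec (x (t + 1) - u)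
            = - ((u - x (t + 1)) ⬝ᵥ ((G (t + 1)).mulVec (x (t + 1) - x t) + (η * (-1 : ℝ) ^ t) • v))
              - (x (t + 1) - u) ⬝ᵥ
          ((G (t + 1)).mulVec (u - x t) + (η * (-1 : ℝ) ^ t) • v) := by
          rw [← neg_sub (x (t + 1)) u, neg_dotProduct, neg_neg, ← dotProduct_sub,
            add_sub_add_right_eq_sub, ← Matrix.mulVec_sub, ← e]
        rw [star_trivial, e4] at h3
        linarith
      exact sub_eq_zero.mp (not_not.mp hzero)
  intro t ht
  rw [hform t ht, smul_dotProduct, hvf, smul_eq_mul, ← mul_assoc, hss, one_mul]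

theorem ag_sum (g : ℕ → ℝ) (T : ℕ) (h0 : g 0 = 0) (hn : ∀ t ≤ T, 0 ≤ g t)
    (hp : ∀ t < T, 1 ≤ g t + g (t + 1)) :
    (T : ℝ) / 2 ≤ ∑ t ∈ Finset.range T, g t + ∑ t ∈ Finset.range T, (-1 : ℝ) ^ t := by
  have main : ∀ t ≤ T, (t : ℝ) / 2 ≤
      ∑ k ∈ Finset.range t, g k + ∑ k ∈ Finset.range t, (-1 : ℝ) ^ k ∧
      (t + 1 : ℝ) / 2 ≤
      ∑ k ∈ Finset.range (t + 1), g k + ∑ k ∈ Finset.range (t + 1), (-1 : ℝ) ^ k := by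
    intro t
    induction t with
    | zero => intro _; simp [h0]; norm_num
    | succ t ih =>
      intro ht
      obtain ⟨h1, h2⟩ := ih (by omega)
      have h3 := hp t (by omega)
      refine ⟨by push_cast; exact h2, ?_⟩
      rw [Finset.sum_range_succ _ (t + 1), Finset.sum_range_succ _ t,
        Finset.sum_range_succ _ (t + 1), Finset.sum_range_succ _ t, pow_succ]
      push_cast
      linarith
  exact (main T le_rfl).1

/-- AdaGrad lower bound (parameter-dependent horizon). There is `N₀ > 0`
such that for every even `N ≥ N₀`, every `η > 0`, `δ > 0`, and every positive `T` with
`T ≤ max(1/(36η²) + 2√δ/(6η), η²N − δ)`, there are loss vectors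
`ℓ_0,…,ℓ_{T-1} ∈ [−1,1]^N` of rank-1 loss matrix such that the AdaGrad run
(`x 0 = (1/N)𝟙`, `S 0 = δI`, `S (t+1) = S t + ℓ_tℓ_tᵀ`, `G (t+1)` the unique symmetric
positive definite square root of `S (t+1)`, `y (t+1) = x t − ηG(t+1)⁻¹ℓ_t`, and
`x (t+1)` the `G (t+1)`-projection of `y (t+1)` onto the simplex) has regret `≥ T/2`. -/
theorem stmt13 :
    ∃ N₀ : ℕ, ∀ (N : ℕ) (_hN₀ : N₀ ≤ N) (_hNpos : 0 < N) (_hNeven : Even N) (η δ : ℝ)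
      (_hη : 0 < η) (_hδ : 0 < δ) (T : ℕ) (_hTpos : 0 < T)
      (_hTle : (T : ℝ) ≤ max (1 / (36 * η ^ 2) + 2 * Real.sqrt δ / (6 * η))
        (η ^ 2 * (N : ℝ) - δ)),
      ∃ ℓ : ℕ → Fin N → ℝ,
        (∀ t < T, ∀ i, |ℓ t i| ≤ 1) ∧
        (Matrix.of fun (i : Fin N) (t : Fin T) => ℓ t i).rank = 1 ∧
        ∀ (S G : ℕ → Matrix (Fin N) (Fin N) ℝ) (y x : ℕ → Fin N → ℝ),
          S 0 = δ • (1 : Matrix (Fin N) (Fin N) ℝ) →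
          (∀ t < T, S (t + 1) = S t + vecMulVec (ℓ t) (ℓ t)) →
          (∀ t < T, (G (t + 1)).IsSymm ∧ (G (t + 1)).PosDef ∧
            G (t + 1) * G (t + 1) = S (t + 1)) →
          (∀ t < T, y (t + 1) = x t - η • (G (t + 1))⁻¹.mulVec (ℓ t)) →
          x 0 = (fun _ => (N : ℝ)⁻¹) →
          (∀ t < T, x (t + 1) ∈ stdSimplex ℝ (Fin N) ∧
            ∀ z ∈ stdSimplex ℝ (Fin N),
              (y (t + 1) - x (t + 1)) ⬝ᵥ (G (t + 1)).mulVec (y (t + 1) - x (t + 1))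
                ≤ (y (t + 1) - z) ⬝ᵥ (G (t + 1)).mulVec (y (t + 1) - z)) →
          (T : ℝ) / 2 ≤
            ∑ t ∈ Finset.range T, ℓ t ⬝ᵥ x t -
              Finset.univ.inf'
                (Finset.univ_nonempty_iff.mpr
                  (Fin.pos_iff_nonempty.mp (by omega)))
                (fun i : Fin N => ∑ t ∈ Finset.range T, ℓ t i) := by
  refine ⟨6, ?_⟩
  intro N hN hNpos hNeven η δ hη hδ T hTpos hTle
  rcases le_max_iff.mp hTle with hT | hT
  · refine ⟨fun _ => (-1 : ℝ) • Pi.single ⟨0, hNpos⟩ (1 : ℝ), ?_, ?_, ?_⟩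
    · intro t _ i
      by_cases h : i = ⟨0, hNpos⟩
      · subst h; simp
      · simp [h]
    · exact ag_rank _ (fun _ => -1) (by intro; norm_num) hTpos ⟨0, hNpos⟩ (by simp)
    · intro S G y x h0 hS hG hy hx0 hx
      have h := ag_slow hN ⟨0, hNpos⟩ η δ hη hδ T hT S G y x h0 hS hG hy hx0 hx
      have hinf := Finset.inf'_le (s := Finset.univ)
        (fun i : Fin N => ∑ t ∈ Finset.range T,
          ((-1 : ℝ) • Pi.single (⟨0, hNpos⟩ : Fin N) (1 : ℝ) : Fin N → ℝ) i)
        (Finset.mem_univ (⟨0, hNpos⟩ : Fin N))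
      have hsum : -((T : ℝ) / 2) ≤ ∑ t ∈ Finset.range T,
          ((-1 : ℝ) • Pi.single (⟨0, hNpos⟩ : Fin N) (1 : ℝ) : Fin N → ℝ) ⬝ᵥ x t := by
        have : ∑ t ∈ Finset.range T, (-(1 / 2) : ℝ) ≤ ∑ t ∈ Finset.range T,
          ((-1 : ℝ) • Pi.single (⟨0, hNpos⟩ : Fin N) (1 : ℝ) : Fin N → ℝ) ⬝ᵥ x t := by
          apply Finset.sum_le_sum
          intro t ht
          have := h t (Finset.mem_range.mp ht).le
          rw [smul_dotProduct, single_dotProduct, smul_eq_mul]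
          linarith
        rw [Finset.sum_const, Finset.card_range, nsmul_eq_mul] at this
        linarith
      have e : ∑ t ∈ Finset.range T,
          ((-1 : ℝ) • Pi.single (⟨0, hNpos⟩ : Fin N) (1 : ℝ) : Fin N → ℝ) ⟨0, hNpos⟩ = -T := by
        simp
      rw [e] at hinf
      linarith
  · have hv1 : ∀ i : Fin N, |(-1 : ℝ) ^ (i : ℕ)| ≤ 1 := by intro i; simp
    have hvv : (fun i : Fin N => (-1 : ℝ) ^ (i : ℕ)) ⬝ᵥ (fun i : Fin N => (-1 : ℝ) ^ (i : ℕ)) = N := by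
      simp [dotProduct, ← mul_pow]
    have hvs : ∑ i : Fin N, (-1 : ℝ) ^ (i : ℕ) = 0 := by
      rw [Fin.sum_univ_eq_sum_range (fun i => (-1 : ℝ) ^ i), neg_one_geom_sum, if_pos hNeven]
    refine ⟨fun t => (-1 : ℝ) ^ t • (fun i : Fin N => (-1 : ℝ) ^ (i : ℕ)), ?_, ?_, ?_⟩
    · intro t _ i
      simp
    · exact ag_rank _ (fun t => (-1 : ℝ) ^ t) (by intro t; rw [← mul_pow]; simp) hTpos
        ⟨0, hNpos⟩ (by simp)
    · intro S G y x h0 hS hG hy hx0 hx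
      obtain ⟨g, hg0, hgn, hgp, hgl⟩ := ag_fast hNpos _ hv1 hvv hvs η δ hη hδ T hT
        S G y x h0 hS hG hy hx0 hx
      have hs := ag_sum g T hg0 hgn hgp
      have hinf := Finset.inf'_le (s := Finset.univ)
        (fun i : Fin N => ∑ t ∈ Finset.range T,
          ((-1 : ℝ) ^ t • (fun i : Fin N => (-1 : ℝ) ^ (i : ℕ))) i)
        (Finset.mem_univ (⟨1, by omega⟩ : Fin N))
      have e1 : ∑ t ∈ Finset.range T, ((-1 : ℝ) ^ t • (fun i : Fin N => (-1 : ℝ) ^ (i : ℕ))) ⬝ᵥ x t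
          = ∑ t ∈ Finset.range T, g t :=
        Finset.sum_congr rfl fun t ht => hgl t (Finset.mem_range.mp ht).le
      have e2 : ∑ t ∈ Finset.range T,
          ((-1 : ℝ) ^ t • (fun i : Fin N => (-1 : ℝ) ^ (i : ℕ))) (⟨1, by omega⟩ : Fin N)
          = - ∑ t ∈ Finset.range T, (-1 : ℝ) ^ t := by
        simp
      rw [e2] at hinf
      rw [e1]
      linarith
end
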